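/- (Uniqueness of viscosity solutions) Assume L : ℝⁿ × ℝⁿ → [0,∞) is continuous, convex in u, and satisfies L(x,u) ≥ Θ(u) with Θ superlinear, and φ : ℝⁿ → [0,∞] is lower semicontinuous. Let W : (0,∞) × ℝⁿ → [0,∞) be continuous, satisfy the initial condition liminf_{h→0+, y→x} W(h,y) = φ(x), the technical conditions D↑W(t,x)(0,0) = 0 and ∃u: D↑W(t,x)(−1,u) < +∞ for all t > 0, and be a viscosity solution of V_t + H(x,−V_x) = 0, i.e., p_t + H(x,−p_x) ≥ 0 for all (p_t,p_x) ∈ ∂₋W(t,x) and p_t + H(x,−p_x) ≤ 0 for all (p_t,p_x) ∈ ∂₊W(t,x). Then W = V on (0,∞) × ℝⁿ, where V is the Bolza value function. -/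

import Mathlib

open Filter Topology Metric Set
open scoped RealInnerProductSpace

noncomputable section

abbrev Euc (n : ℕ) := EuclideanSpace ℝ (Fin n)

def contCone {F : Type*} [NormedAddCommGroup F] [NormedSpace ℝ F] (K : Set F) (x : F) : Set F :=
  {v | ∀ ε > 0, ∃ h : ℝ, 0 < h ∧ h < ε ∧ Metric.infDist (x + h • v) K < ε * h}

def Dup {F : Type*} [NormedAddCommGroup F] [NormedSpace ℝ F]
    (W : F → EReal) (x u : F) : EReal :=
  Filter.liminf (fun p : ℝ × F => ((p.1⁻¹ : ℝ) : EReal) * (W (x + p.1 • p.2) - W x))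
    ((𝓝[>] (0:ℝ)) ×ˢ 𝓝 u)

def Ham {n : ℕ} (L : Euc n → Euc n → ℝ) (x p : Euc n) : EReal :=
  ⨆ u : Euc n, ((⟪p, u⟫ - L x u : ℝ) : EReal)

def subdiffP {n : ℕ} (W : ℝ × Euc n → EReal) (q : ℝ × Euc n) : Set (ℝ × Euc n) :=
  {p | ∀ ε > 0, ∀ᶠ z in 𝓝 q,
    W q + ((p.1 * (z.1 - q.1) + ⟪p.2, z.2 - q.2⟫ - ε * ‖z - q‖ : ℝ) : EReal) ≤ W z}

def bolzaValue {n : ℕ} (L : Euc n → Euc n → ℝ) (φ : Euc n → EReal) (t : ℝ) (x : Euc n) : EReal :=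
  sInf {c : EReal | ∃ u : ℝ → Euc n,
    IntervalIntegrable u MeasureTheory.volume 0 t ∧
    IntervalIntegrable (fun s => L (x + ∫ τ in (0:ℝ)..s, u τ) (u s)) MeasureTheory.volume 0 t ∧
    c = ((∫ s in (0:ℝ)..t, L (x + ∫ τ in (0:ℝ)..s, u τ) (u s) : ℝ) : EReal)
        + φ (x + ∫ τ in (0:ℝ)..t, u τ)}

def Superlinear {n : ℕ} (Θ : Euc n → ℝ) : Prop :=
  Filter.Tendsto (fun u : Euc n => Θ u / ‖u‖) (Filter.comap norm Filter.atTop) Filter.atTop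

def negPolar {n : ℕ} (T : Set (Euc n)) : Set (Euc n) :=
  {v | ∀ w ∈ T, ⟪v, w⟫ ≤ 0}

def rsubdiffP {n : ℕ} (W : ℝ × Euc n → ℝ) (q : ℝ × Euc n) : Set (ℝ × Euc n) :=
  {p | ∀ ε > 0, ∀ᶠ z in 𝓝 q,
    W q + (p.1 * (z.1 - q.1) + ⟪p.2, z.2 - q.2⟫) - ε * ‖z - q‖ ≤ W z}

def rsupdiffP {n : ℕ} (W : ℝ × Euc n → ℝ) (q : ℝ × Euc n) : Set (ℝ × Euc n) :=
  {p | ∀ ε > 0, ∀ᶠ z in 𝓝 q,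
    W z ≤ W q + (p.1 * (z.1 - q.1) + ⟪p.2, z.2 - q.2⟫) + ε * ‖z - q‖}

theorem Superlinear.exists_bound {n : ℕ} {Θ : Euc n → ℝ} (h : Superlinear Θ)
    (h0 : ∀ u, 0 ≤ Θ u) {K : ℝ} (hK : 0 < K) :
    ∃ R, 0 ≤ R ∧ ∀ u, K * ‖u‖ ≤ K * R + Θ u := by
  have h1 := (tendsto_atTop.1 h) K
  rw [eventually_comap] at h1
  obtain ⟨R, hR⟩ := eventually_atTop.1 h1
  refine ⟨max R 1, by positivity, fun u => ?_⟩
  rcases le_total (max R 1) ‖u‖ with hu | hu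
  · have h2 := hR ‖u‖ ((le_max_left _ _).trans hu) u rfl
    have h3 : 0 < ‖u‖ := by linarith [le_max_right R 1]
    rw [le_div_iff₀ h3] at h2
    have : 0 ≤ K * max R 1 := by positivity
    linarith
  · have := mul_le_mul_of_nonneg_left hu hK.le
    linarith [h0 u]

theorem exists_affine_minorant {n : ℕ} {f : Euc n → ℝ} (hf : ConvexOn ℝ Set.univ f)
    (hc : Continuous f) (v : Euc n) {a : ℝ} (ha : a < f v) :
    ∃ (c : ℝ) (p : Euc n), (∀ w, c + ⟪p, w⟫ ≤ f w) ∧ c + ⟪p, v⟫ = a := by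
  obtain ⟨l, c, h1, h2⟩ := ConvexOn.exists_affine_le_of_lt (𝕜 := ℝ) (mem_univ v) ha isClosed_univ
    (hc.lowerSemicontinuous.lowerSemicontinuousOn _) hf
  refine ⟨c, (InnerProductSpace.toDual ℝ (Euc n)).symm l, fun w => ?_, ?_⟩
  · have := h1 ⟨w, mem_univ w⟩
    rw [InnerProductSpace.toDual_symm_apply, add_comm]
    simpa using this
  · rw [InnerProductSpace.toDual_symm_apply, add_comm]
    simpa using h2

/-- An affine minorant of `L x₀` remains, up to `η`, a minorant of `L x` for `x` near `x₀`:
far away this follows from superlinearity, on bounded sets from continuity. -/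
theorem affine_minorant_stable {n : ℕ} {L : Euc n → Euc n → ℝ} {Θ : Euc n → ℝ}
    (hLc : Continuous (fun q : Euc n × Euc n => L q.1 q.2))
    (hΘ0 : ∀ u, 0 ≤ Θ u) (hΘ : Superlinear Θ) (hcoer : ∀ x u, Θ u ≤ L x u)
    {x₀ p : Euc n} {c η : ℝ} (hη : 0 < η) (h : ∀ w, c + ⟪p, w⟫ ≤ L x₀ w) :
    ∃ ρ > 0, ∀ x, dist x x₀ ≤ ρ → ∀ w, c - η + ⟪p, w⟫ ≤ L x w := by
  obtain ⟨R, hR0, hR⟩ := hΘ.exists_bound hΘ0 (K := ‖p‖ + 1) (by positivity)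
  have key : ∀ᶠ x in 𝓝 x₀, ∀ w ∈ closedBall (0 : Euc n) (c + (‖p‖ + 1) * R),
      L x₀ w - η < L x w := by
    refine (isCompact_closedBall _ _).eventually_forall_of_forall_eventually fun w _ => ?_
    have h1 : ContinuousAt (fun q : Euc n × Euc n => L x₀ q.2 - η - L q.1 q.2) (x₀, w) := by
      have : Continuous (fun q : Euc n × Euc n => L x₀ q.2) :=
        hLc.comp (continuous_const.prodMk continuous_snd)
      exact ((this.sub continuous_const).sub hLc).continuousAt
    have h2 := h1.eventually_lt_const (show L x₀ w - η - L x₀ w < 0 by linarith)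
    filter_upwards [h2] with q hq
    linarith
  obtain ⟨ρ, hρ, hball⟩ := Metric.eventually_nhds_iff_ball.1 key
  refine ⟨ρ / 2, by positivity, fun x hx w => ?_⟩
  by_cases hw : w ∈ closedBall (0 : Euc n) (c + (‖p‖ + 1) * R)
  · have := hball x (by rw [mem_ball]; linarith) w hw
    linarith [h w]
  · rw [mem_closedBall, dist_zero_right, not_le] at hw
    have h1 := hR w
    have h2 := hcoer x w
    have h3 := real_inner_le_norm p w
    linarith

theorem mem_rsupdiffP_of_quadratic {n : ℕ} {W : ℝ × Euc n → ℝ} {q p : ℝ × Euc n} {C : ℝ}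
    (h : ∀ᶠ z in 𝓝 q, W z ≤ W q + (p.1 * (z.1 - q.1) + ⟪p.2, z.2 - q.2⟫)
      + C * ((z.1 - q.1) ^ 2 + ‖z.2 - q.2‖ ^ 2)) : p ∈ rsupdiffP W q := by
  intro ε hε
  have h2 : ∀ᶠ z in 𝓝 q, ‖z - q‖ < ε / (2 * |C| + 1) := by
    have : ContinuousAt (fun z : ℝ × Euc n => ‖z - q‖) q := by fun_prop
    exact this.eventually_lt_const (by simp; positivity)
  filter_upwards [h, h2] with z h1 h2
  refine h1.trans ?_
  have a1 : |z.1 - q.1| ≤ ‖z - q‖ := norm_fst_le (z - q)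
  have a2 : ‖z.2 - q.2‖ ≤ ‖z - q‖ := norm_snd_le (z - q)
  have b1 : (z.1 - q.1) ^ 2 ≤ ‖z - q‖ ^ 2 := by
    rw [← sq_abs]; gcongr
  have b2 : ‖z.2 - q.2‖ ^ 2 ≤ ‖z - q‖ ^ 2 := by gcongr
  have h3 : ‖z - q‖ * (2 * |C| + 1) ≤ ε := by
    rw [lt_div_iff₀ (by positivity)] at h2; exact h2.le
  have h4 : C * ((z.1 - q.1) ^ 2 + ‖z.2 - q.2‖ ^ 2) ≤ |C| * (2 * ‖z - q‖ ^ 2) := by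
    refine (mul_le_mul_of_nonneg_right (le_abs_self C) (by positivity)).trans ?_
    gcongr
    linarith
  have h5 := mul_le_mul_of_nonneg_right h3 (norm_nonneg (z - q))
  nlinarith [norm_nonneg (z - q)]

theorem mem_rsubdiffP_of_quadratic {n : ℕ} {W : ℝ × Euc n → ℝ} {q p : ℝ × Euc n} {C : ℝ}
    (h : ∀ᶠ z in 𝓝 q, W q + (p.1 * (z.1 - q.1) + ⟪p.2, z.2 - q.2⟫)
      - C * ((z.1 - q.1) ^ 2 + ‖z.2 - q.2‖ ^ 2) ≤ W z) : p ∈ rsubdiffP W q := by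
  have : -p ∈ rsupdiffP (fun z => -W z) q := by
    refine mem_rsupdiffP_of_quadratic (C := C) ?_
    filter_upwards [h] with z hz
    simp only [Prod.fst_neg, Prod.snd_neg, inner_neg_left]
    linarith
  intro ε hε
  filter_upwards [this ε hε] with z hz
  simp only [Prod.fst_neg, Prod.snd_neg, inner_neg_left] at hz
  linarith

theorem sq_min_zero_sub_le (s a : ℝ) :
    (min (s - a) 0) ^ 2 ≤ (min s 0) ^ 2 - 2 * min s 0 * a + a ^ 2 := by
  rcases min_cases (s - a) 0 with ⟨h1, h2⟩ | ⟨h1, h2⟩ <;>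
    rcases min_cases s 0 with ⟨h3, h4⟩ | ⟨h3, h4⟩ <;> rw [h1, h3] <;> nlinarith [sq_nonneg (s - a)]

/-- Subsolutions decrease along straight segments at most at the rate given by the Lagrangian. -/
theorem le_along_segment {n : ℕ} {L : Euc n → Euc n → ℝ}
    {W : ℝ × Euc n → ℝ} (hLc : Continuous (fun q : Euc n × Euc n => L q.1 q.2))
    (hWc : ContinuousOn W {q : ℝ × Euc n | 0 < q.1})
    (hsub : ∀ t : ℝ, ∀ x : Euc n, 0 < t → ∀ p ∈ rsupdiffP W (t, x),
      (p.1 : ℝ) + Ham L x (-p.2) ≤ (0 : EReal))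
    {τ A M : ℝ} {y u : Euc n} (hA : 0 < A) (hτ : A < τ)
    (hM : ∀ s ∈ Icc 0 A, L (y + s • u) u < M) :
    W (τ, y) ≤ A * M + W (τ - A, y + A • u) := by
  by_contra! hcon
  have hWat : ∀ q : ℝ × Euc n, 0 < q.1 → ContinuousAt W q := fun q hq =>
    hWc.continuousAt ((isOpen_lt continuous_const continuous_fst).mem_nhds hq)
  have e1 : ∀ᶠ d : ℝ × Euc n in 𝓝 0, ∀ s ∈ Icc 0 A, L (y + s • u + d.1 • u + d.2) u < M := by
    refine isCompact_Icc.eventually_forall_of_forall_eventually fun s hs => ?_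
    have : Continuous (fun q : (ℝ × Euc n) × ℝ => L (y + q.2 • u + q.1.1 • u + q.1.2) u) :=
      hLc.comp (Continuous.prodMk (by fun_prop) continuous_const)
    exact this.continuousAt.eventually_lt_const (by simpa using hM s hs)
  have e2 : ∀ᶠ d : ℝ × Euc n in 𝓝 0, A * M + W (τ - A, y + A • u + d.2) < W (τ, y) := by
    have h1 : ContinuousAt (fun d : ℝ × Euc n => A * M + W (τ - A, y + A • u + d.2)) 0 := by
      refine continuousAt_const.add (ContinuousAt.comp (g := W) ?_ (by fun_prop))
      exact hWat _ (by simp; linarith)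
    exact h1.eventually_lt_const (by simpa using hcon)
  obtain ⟨r, hr, hball⟩ := Metric.eventually_nhds_iff_ball.1 (e1.and e2)
  obtain ⟨δ, hδ, hδr⟩ := exists_between hr
  have hL : ∀ s ∈ Icc (-δ) A, ∀ e : Euc n, ‖e‖ ≤ δ → L (y + s • u + e) u < M := by
    intro s hs e he
    rcases le_total 0 s with h0 | h0
    · have := (hball (0, e) (by
        rw [mem_ball, dist_zero_right, Prod.norm_def]; simp; linarith)).1
          s ⟨h0, hs.2⟩
      simpa using this
    · have := (hball (s, e) (by
        rw [mem_ball, dist_zero_right, Prod.norm_def]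
        simp [abs_of_nonpos h0]; constructor <;> linarith [hs.1])).1 0 ⟨le_rfl, hA.le⟩
      simpa using this
  have hend : ∀ e : Euc n, ‖e‖ ≤ δ → A * M + W (τ - A, y + A • u + e) < W (τ, y) := by
    intro e he
    exact (hball (0, e) (by
      rw [mem_ball, dist_zero_right, Prod.norm_def]; simp; linarith)).2
  set S : Set (ℝ × Euc n) := Icc (-δ) A ×ˢ closedBall 0 δ with hS
  have hScomp : IsCompact S := isCompact_Icc.prod (isCompact_closedBall _ _)
  have hGc : ContinuousOn (fun d : ℝ × Euc n => W (τ - d.1, y + d.1 • u + d.2) + M * d.1) S := by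
    intro d hd
    refine ContinuousAt.continuousWithinAt ?_
    refine ContinuousAt.add (ContinuousAt.comp (g := W) (hWat _ ?_) (by fun_prop)) (by fun_prop)
    simp only
    linarith [hd.1.2]
  have h0S : (0 : ℝ × Euc n) ∈ S := by
    simp only [hS, mem_prod, mem_Icc, mem_closedBall, Prod.fst_zero, Prod.snd_zero, dist_self]
    exact ⟨⟨by linarith, hA.le⟩, hδ.le⟩
  obtain ⟨B, hB⟩ := hScomp.bddAbove_image hGc
  have hB' : ∀ d ∈ S, W (τ - d.1, y + d.1 • u + d.2) + M * d.1 ≤ B := fun d hd =>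
    hB (mem_image_of_mem _ hd)
  set k : ℝ := (B - W (τ, y) + 1) / δ ^ 2 with hk
  have hB0 : W (τ, y) ≤ B := by simpa using hB' 0 h0S
  have hk0 : 0 < k := by positivity
  have hkδ : B - k * δ ^ 2 < W (τ, y) := by
    rw [hk, div_mul_cancel₀ _ (by positivity)]; linarith
  obtain ⟨d, hdS, hdmax⟩ := hScomp.exists_isMaxOn ⟨0, h0S⟩
    (f := fun d : ℝ × Euc n => W (τ - d.1, y + d.1 • u + d.2) + M * d.1
      - k * ((min d.1 0) ^ 2 + ‖d.2‖ ^ 2)) (hGc.sub (by fun_prop))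
  obtain ⟨s, e⟩ := d
  have hmax : ∀ z ∈ S, W (τ - z.1, y + z.1 • u + z.2) + M * z.1
      - k * ((min z.1 0) ^ 2 + ‖z.2‖ ^ 2) ≤ W (τ - s, y + s • u + e) + M * s
      - k * ((min s 0) ^ 2 + ‖e‖ ^ 2) := fun z hz => hdmax hz
  have hge : W (τ, y) ≤ W (τ - s, y + s • u + e) + M * s
      - k * ((min s 0) ^ 2 + ‖e‖ ^ 2) := by simpa using hmax 0 h0S
  have hse := hB' _ hdS
  simp only at hse
  have hs1 : -δ ≤ s := hdS.1.1
  have hs2 : s ≤ A := hdS.1.2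
  have he1 : ‖e‖ ≤ δ := by simpa using hdS.2
  have hs1' : -δ < s := by
    refine lt_of_le_of_ne hs1 fun h => ?_
    rw [← h, min_eq_left (by linarith)] at hge
    rw [← h] at hse
    nlinarith [sq_nonneg ‖e‖]
  have he1' : ‖e‖ < δ := by
    refine lt_of_le_of_ne he1 fun h => ?_
    rw [h] at hge
    nlinarith [sq_nonneg (min s 0)]
  have hs2' : s < A := by
    refine lt_of_le_of_ne hs2 fun h => ?_
    have := hend e he1
    rw [h] at hge
    have h1 : 0 ≤ k * ((min A 0) ^ 2 + ‖e‖ ^ 2) := by positivity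
    linarith
  set q : ℝ × Euc n := (τ - s, y + s • u + e) with hq
  have hInt : ∀ᶠ z : ℝ × Euc n in 𝓝 q, (τ - z.1, z.2 - y - (τ - z.1) • u) ∈ S := by
    have h1 : ContinuousAt (fun z : ℝ × Euc n => (τ - z.1, z.2 - y - (τ - z.1) • u)) q := by
      fun_prop
    have h2 : S ∈ 𝓝 (s, e) :=
      prod_mem_nhds (Icc_mem_nhds hs1' hs2') (closedBall_mem_nhds_of_mem (by simpa using he1'))
    refine h1.eventually_mem ?_
    convert h2 using 2
    simp [hq, add_sub_cancel_left, add_assoc]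
  have hp : (M - 2 * k * min s 0 + 2 * k * ⟪e, u⟫, (2 * k) • e) ∈ rsupdiffP W q := by
    refine mem_rsupdiffP_of_quadratic (C := k * (1 + 2 * ‖u‖ ^ 2) + 2 * k) ?_
    filter_upwards [hInt] with z hz
    have h1 := hmax _ hz
    obtain ⟨α, hα⟩ : ∃ α, α = z.1 - (τ - s) := ⟨_, rfl⟩
    obtain ⟨β, hβ⟩ : ∃ β, β = z.2 - (y + s • u + e) := ⟨_, rfl⟩
    have hz1 : τ - z.1 = s - α := by rw [hα]; ring
    have hz2 : z.2 - y - (τ - z.1) • u = e + (β + α • u) := by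
      rw [hβ, hz1, sub_smul]; abel
    simp only [hq, ← hα, ← hβ]
    simp only [hz2] at h1
    rw [show (τ - (τ - z.1), y + (τ - z.1) • u + (e + (β + α • u))) = z from
      Prod.ext (by simp) (by simp only; rw [← hz2]; abel), hz1] at h1
    have h2 := sq_min_zero_sub_le s α
    have h3 : ‖e + (β + α • u)‖ ^ 2 = ‖e‖ ^ 2 + 2 * (⟪e, β⟫ + α * ⟪e, u⟫) + ‖β + α • u‖ ^ 2 := by
      rw [norm_add_sq_real, inner_add_right, inner_smul_right]
    have h4 : ‖β + α • u‖ ^ 2 ≤ 2 * ‖β‖ ^ 2 + 2 * (α ^ 2 * ‖u‖ ^ 2) := by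
      have h5 : ‖β + α • u‖ ≤ ‖β‖ + |α| * ‖u‖ := by
        simpa [norm_smul] using norm_add_le β (α • u)
      have h6 : ‖β + α • u‖ ^ 2 ≤ (‖β‖ + |α| * ‖u‖) ^ 2 := by gcongr
      have h7 : (|α| * ‖u‖) ^ 2 = α ^ 2 * ‖u‖ ^ 2 := by rw [mul_pow, sq_abs]
      nlinarith [sq_nonneg (‖β‖ - |α| * ‖u‖)]
    rw [h3] at h1
    rw [inner_smul_left]
    simp only [conj_trivial]
    have h8 := mul_le_mul_of_nonneg_left h2 hk0.le
    have h9 := mul_le_mul_of_nonneg_left h4 hk0.le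
    have h10 : 0 ≤ k * (‖u‖ ^ 2 * ‖β‖ ^ 2) := by positivity
    have h11 : 0 ≤ k * α ^ 2 := by positivity
    have h12 : 0 ≤ k * ‖β‖ ^ 2 := by positivity
    nlinarith
  have hH := hsub (τ - s) (y + s • u + e) (by linarith) _ hp
  have hlow : ((⟪-((2 * k) • e), u⟫ - L (y + s • u + e) u : ℝ) : EReal)
      ≤ Ham L (y + s • u + e) (-((2 * k) • e)) := le_iSup (fun v : Euc n =>
      ((⟪-((2 * k) • e), v⟫ - L (y + s • u + e) v : ℝ) : EReal)) u
  have h1 := (add_le_add_right hlow ((M - 2 * k * min s 0 + 2 * k * ⟪e, u⟫ : ℝ) : EReal)).trans hH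
  rw [← EReal.coe_add, ← EReal.coe_zero, EReal.coe_le_coe_iff, inner_neg_left, inner_smul_left] at h1
  simp only [conj_trivial] at h1
  have h2 := hL s ⟨hs1, hs2⟩ e he1
  have h3 : k * min s 0 ≤ 0 := mul_nonpos_of_nonneg_of_nonpos hk0.le (min_le_right _ _)
  linarith

/-- `y` is, up to an error `ε` in the state variable, a trajectory on `[0, T]` whose running cost
is at most `g`: increments of `g` dominate those of every affine minorant of `L`. -/
def IsApproxTrajectory {n : ℕ} (L : Euc n → Euc n → ℝ) (ε T : ℝ) (y : ℝ → Euc n) (g : ℝ → ℝ) :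
    Prop :=
  ∀ (s s' c : ℝ) (p : Euc n), 0 ≤ s → s ≤ s' → s' ≤ T →
    (∀ r ∈ Icc s s', ∀ x, dist x (y r) ≤ ε → ∀ w, c + ⟪p, w⟫ ≤ L x w) →
    c * (s' - s) + ⟪p, y s' - y s⟫ ≤ g s' - g s

theorem IsApproxTrajectory.extend {n : ℕ} {L : Euc n → Euc n → ℝ} {ε T h : ℝ} {y : ℝ → Euc n}
    {g : ℝ → ℝ} (hyg : IsApproxTrajectory L ε T y g) {z u : Euc n}
    (hz : ∀ r ∈ Icc 0 h, dist z (y T + r • u) ≤ ε) :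
    IsApproxTrajectory L ε (T + h) (fun s => y (min s T) + max (s - T) 0 • u)
      (fun s => g (min s T) + max (s - T) 0 * L z u) := by
  intro s s' c p hs hss hs' hmin
  have left : ∀ r ≤ T, min r T = r ∧ max (r - T) 0 = 0 := fun r hr =>
    ⟨min_eq_left hr, max_eq_right (by linarith)⟩
  have right : ∀ r, T ≤ r → min r T = T ∧ max (r - T) 0 = r - T := fun r hr =>
    ⟨min_eq_right hr, max_eq_left (by linarith)⟩
  have partL : ∀ b ∈ Icc s s', b ≤ T → c * (b - s) + ⟪p, y b - y s⟫ ≤ g b - g s := by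
    intro b hb hbT
    refine hyg s b c p hs hb.1 hbT fun r hr x hx => hmin r ⟨hr.1, hr.2.trans hb.2⟩ x ?_
    simpa [(left r (hr.2.trans hbT)).1, (left r (hr.2.trans hbT)).2] using hx
  have partR : ∀ b ∈ Icc s s', T ≤ b → c + ⟪p, u⟫ ≤ L z u := by
    intro b hb hbT
    refine hmin b hb z ?_ u
    simp only [(right b hbT).1, (right b hbT).2]
    exact hz _ ⟨by linarith, by linarith [hb.2]⟩
  simp only
  rcases le_total s' T with h1 | h1
  · have := partL s' ⟨hss, le_rfl⟩ h1
    simpa [left s' h1, left s (hss.trans h1)] using this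
  · rcases le_total T s with h2 | h2
    · have h3 := mul_le_mul_of_nonneg_left (partR s ⟨le_rfl, hss⟩ h2) (sub_nonneg.2 hss)
      rw [(right s h2).1, (right s h2).2, (right s' h1).1, (right s' h1).2,
        add_sub_add_left_eq_sub, ← sub_smul, inner_smul_right]
      linarith
    · have h3 := mul_le_mul_of_nonneg_left (partR T ⟨h2, h1⟩ le_rfl) (sub_nonneg.2 h1)
      have h4 := partL T ⟨h2, h1⟩ le_rfl
      rw [(left s h2).1, (left s h2).2, (right s' h1).1, (right s' h1).2, zero_smul, add_zero,
        add_sub_right_comm, inner_add_right, inner_smul_right]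
      linarith

theorem IsApproxTrajectory.mono_cost {n : ℕ} {L : Euc n → Euc n → ℝ} (hL0 : ∀ x u, 0 ≤ L x u)
    {ε T : ℝ} {y : ℝ → Euc n} {g : ℝ → ℝ} (hyg : IsApproxTrajectory L ε T y g) {s s' : ℝ}
    (hs : 0 ≤ s) (hss : s ≤ s') (hs' : s' ≤ T) : g s ≤ g s' := by
  have := hyg s s' 0 0 hs hss hs' (by intro r _ x _ w; simpa using hL0 x w)
  simpa using this

/-- Coercivity turns the cost into a bound on increments, uniformly over all trajectories. -/
theorem IsApproxTrajectory.norm_sub_le {n : ℕ} {L : Euc n → Euc n → ℝ} {Θ : Euc n → ℝ}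
    (hcoer : ∀ x u, Θ u ≤ L x u) {K R : ℝ} (hK : 0 < K) (hR : ∀ u, K * ‖u‖ ≤ K * R + Θ u)
    {ε T : ℝ} {y : ℝ → Euc n} {g : ℝ → ℝ} (hyg : IsApproxTrajectory L ε T y g) {s s' : ℝ}
    (hs : 0 ≤ s) (hss : s ≤ s') (hs' : s' ≤ T) :
    K * ‖y s' - y s‖ ≤ K * R * (s' - s) + (g s' - g s) := by
  have h1 := hyg s s' (-(K * R)) ((K * ‖y s' - y s‖⁻¹) • (y s' - y s)) hs hss hs' (by
    intro r _ x _ w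
    have h2 : ⟪(K * ‖y s' - y s‖⁻¹) • (y s' - y s), w⟫ ≤ K * ‖w‖ := by
      refine (real_inner_le_norm _ _).trans (mul_le_mul_of_nonneg_right ?_ (norm_nonneg w))
      rw [norm_smul, norm_mul, norm_inv, norm_norm, Real.norm_of_nonneg hK.le, mul_assoc]
      exact mul_le_of_le_one_right hK.le (inv_mul_le_one)
    linarith [hcoer x w, hR w])
  rw [inner_smul_left, real_inner_self_eq_norm_sq] at h1
  simp only [conj_trivial] at h1
  have h3 : K * ‖y s' - y s‖⁻¹ * ‖y s' - y s‖ ^ 2 = K * ‖y s' - y s‖ := by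
    rcases eq_or_ne ‖y s' - y s‖ 0 with h0 | h0
    · simp [h0]
    · field_simp
  linarith

/-- The penalised function minimised in the definition of the inf-convolution of `W`. -/
def penalised {n : ℕ} (W : ℝ × Euc n → ℝ) (k : ℝ) (q z : ℝ × Euc n) : ℝ :=
  W z + k * ((q.1 - z.1) ^ 2 + ‖q.2 - z.2‖ ^ 2)

theorem exists_ham_maximiser {n : ℕ} {L : Euc n → Euc n → ℝ} {x : Euc n} {p : ℝ × Euc n}
    (h : (0 : EReal) ≤ (p.1 : ℝ) + Ham L x (-p.2)) {η : ℝ} (hη : 0 < η) :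
    ∃ u, L x u < p.1 + η - ⟪p.2, u⟫ := by
  have h1 : ((-p.1 - η : ℝ) : EReal) < Ham L x (-p.2) := by
    by_contra! hcon
    have := h.trans (add_le_add_right hcon _)
    rw [← EReal.coe_add, ← EReal.coe_zero, EReal.coe_le_coe_iff] at this
    linarith
  obtain ⟨u, hu⟩ := lt_iSup_iff.1 h1
  rw [EReal.coe_lt_coe_iff, inner_neg_left] at hu
  exact ⟨u, by linarith⟩

/-- One step of the descent of the inf-convolution of a supersolution, with a bound on the
velocity that does not depend on the position. -/
theorem exists_descent_step {n : ℕ} {L : Euc n → Euc n → ℝ} {Θ : Euc n → ℝ} {W : ℝ × Euc n → ℝ}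
    (hΘ0 : ∀ u, 0 ≤ Θ u) (hΘ : Superlinear Θ) (hcoer : ∀ x u, Θ u ≤ L x u)
    (hW0 : ∀ q : ℝ × Euc n, 0 < q.1 → 0 ≤ W q)
    (hWc : ContinuousOn W {q : ℝ × Euc n | 0 < q.1})
    (hsuper : ∀ t : ℝ, ∀ x : Euc n, 0 < t → ∀ p ∈ rsubdiffP W (t, x),
      (0 : EReal) ≤ (p.1 : ℝ) + Ham L x (-p.2))
    {k C D η : ℝ} (hk : 0 < k) (hD : 0 < D) (hC : C < k * D ^ 2) (hη : 0 < η) :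
    ∃ R, 0 ≤ R ∧ ∀ q z : ℝ × Euc n, D < q.1 → 0 < z.1 → penalised W k q z ≤ C →
      ∃ (z' : ℝ × Euc n) (u : Euc n), 0 < z'.1 ∧ ‖q.2 - z'.2‖ ≤ D ∧ ‖u‖ ≤ R ∧
        ∀ h, 0 ≤ h → penalised W k (q.1 - h, q.2 + h • u) z' ≤
          penalised W k q z - h * L z'.2 u + h * η + k * h ^ 2 * (1 + R ^ 2) := by
  obtain ⟨R, hR0, hR⟩ := hΘ.exists_bound hΘ0 (K := 2 * k * D + 1) (by positivity)
  refine ⟨(2 * k * D + 1) * R + 2 * k * D + η, by positivity, fun q z hq hz hqz => ?_⟩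
  set R' := (2 * k * D + 1) * R + 2 * k * D + η
  have near : ∀ z : ℝ × Euc n, 0 < z.1 → penalised W k q z ≤ C →
      |q.1 - z.1| < D ∧ ‖q.2 - z.2‖ < D := by
    intro z hz hqz
    unfold penalised at hqz
    have h1 := hW0 z hz
    have h2 : (q.1 - z.1) ^ 2 + ‖q.2 - z.2‖ ^ 2 < D ^ 2 :=
      lt_of_mul_lt_mul_left (by linarith) hk.le
    exact ⟨abs_lt_of_sq_lt_sq (by nlinarith [sq_nonneg ‖q.2 - z.2‖]) hD.le,
      lt_of_pow_lt_pow_left₀ 2 hD.le (by nlinarith [sq_nonneg (q.1 - z.1)])⟩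
  set B : Set (ℝ × Euc n) := closedBall q.1 D ×ˢ closedBall q.2 D
  have hBpos : ∀ z ∈ B, 0 < z.1 := by
    intro z hz
    have := hz.1
    rw [mem_closedBall, Real.dist_eq] at this
    linarith [(abs_le.1 this).1]
  have hzB : ∀ z : ℝ × Euc n, 0 < z.1 → penalised W k q z ≤ C → z ∈ ball q.1 D ×ˢ ball q.2 D := by
    intro z hz hqz
    obtain ⟨h1, h2⟩ := near z hz hqz
    refine ⟨?_, ?_⟩
    · rwa [mem_ball, dist_comm, Real.dist_eq]
    · rwa [mem_ball, dist_comm, dist_eq_norm]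
  have hsubB : ball q.1 D ×ˢ ball q.2 D ⊆ B := prod_mono ball_subset_closedBall ball_subset_closedBall
  obtain ⟨z', hz'B, hz'min⟩ := ((isCompact_closedBall q.1 D).prod
    (isCompact_closedBall q.2 D)).exists_isMinOn ⟨z, hsubB (hzB z hz hqz)⟩
    (f := penalised W k q) (by
      refine ContinuousOn.add (hWc.mono fun z hz => hBpos z hz) (Continuous.continuousOn ?_)
      fun_prop)
  have hle : penalised W k q z' ≤ penalised W k q z := hz'min (hsubB (hzB z hz hqz))
  have hz'0 := hBpos z' hz'B
  obtain ⟨n1, n2⟩ := near z' hz'0 (hle.trans hqz)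
  have hev : ∀ᶠ z in 𝓝 z', penalised W k q z' ≤ penalised W k q z := by
    filter_upwards [(isOpen_ball.prod isOpen_ball).mem_nhds (hzB z' hz'0 (hle.trans hqz))] with z hz
    exact hz'min (hsubB hz)
  have hp : (2 * k * (q.1 - z'.1), (2 * k) • (q.2 - z'.2)) ∈ rsubdiffP W z' := by
    refine mem_rsubdiffP_of_quadratic (C := k) ?_
    filter_upwards [hev] with z hz
    unfold penalised at hz
    have h1 : ‖q.2 - z.2‖ ^ 2 = ‖q.2 - z'.2‖ ^ 2 - 2 * ⟪q.2 - z'.2, z.2 - z'.2⟫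
        + ‖z.2 - z'.2‖ ^ 2 := by
      rw [← norm_sub_sq_real, sub_sub_sub_cancel_right]
    rw [h1] at hz
    simp only [inner_smul_left, conj_trivial]
    nlinarith
  obtain ⟨u, hu⟩ := exists_ham_maximiser (hsuper z'.1 z'.2 hz'0 _ hp) hη
  simp only [inner_smul_left, conj_trivial] at hu
  have hi : |⟪q.2 - z'.2, u⟫| ≤ D * ‖u‖ :=
    (abs_real_inner_le_norm _ _).trans (by gcongr)
  have hkD : 0 < k * D := by positivity
  have hu' : ‖u‖ ≤ R' := by
    have h1 := hR u
    have h2 := hcoer z'.2 u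
    have h3 : k * (q.1 - z'.1) ≤ k * D :=
      mul_le_mul_of_nonneg_left ((le_abs_self _).trans n1.le) hk.le
    have h4 : -(k * ⟪q.2 - z'.2, u⟫) ≤ k * (D * ‖u‖) := by
      rw [← mul_neg]
      exact mul_le_mul_of_nonneg_left ((neg_le_abs _).trans hi) hk.le
    linarith
  refine ⟨z', u, hz'0, n2.le, hu', fun h hh => ?_⟩
  refine le_trans ?_ (show penalised W k q z' - h * L z'.2 u + h * η + k * h ^ 2 * (1 + R' ^ 2)
    ≤ _ by linarith)
  unfold penalised
  have h1 : ‖q.2 + h • u - z'.2‖ ^ 2 = ‖q.2 - z'.2‖ ^ 2 + 2 * (h * ⟪q.2 - z'.2, u⟫)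
      + h ^ 2 * ‖u‖ ^ 2 := by
    rw [add_sub_right_comm, norm_add_sq_real, inner_smul_right, norm_smul, mul_pow,
      Real.norm_eq_abs, sq_abs]
  simp only [h1]
  have h2 : k * h ^ 2 * ‖u‖ ^ 2 ≤ k * h ^ 2 * R' ^ 2 := by gcongr
  have h3 := mul_le_mul_of_nonneg_left hu.le hh
  nlinarith

/-- Iterating the descent step produces an approximate trajectory along which the cost is
controlled by the decrease of the penalised function. -/
theorem exists_iterated_descent {n : ℕ} {L : Euc n → Euc n → ℝ} {W : ℝ × Euc n → ℝ}
    (hL0 : ∀ x u, 0 ≤ L x u) {k C D η ε R t h : ℝ} {N : ℕ} (x : Euc n) (ht : 0 < t) (hh0 : 0 < h)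
    (hη0 : 0 < η) (hstep : ∀ q z : ℝ × Euc n, D < q.1 → 0 < z.1 → penalised W k q z ≤ C →
      ∃ (z' : ℝ × Euc n) (u : Euc n), 0 < z'.1 ∧ ‖q.2 - z'.2‖ ≤ D ∧ ‖u‖ ≤ R ∧
        ∀ h, 0 ≤ h → penalised W k (q.1 - h, q.2 + h • u) z' ≤
          penalised W k q z - h * L z'.2 u + h * η + k * h ^ 2 * (1 + R ^ 2))
    (hNt : N * h + D < t) (hC : W (t, x) + 2 * η * (N * h) ≤ C)
    (hh1 : k * h * (1 + R ^ 2) ≤ η) (hh2 : D + h * R ≤ ε) :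
    ∀ i : ℕ, i ≤ N → ∃ (y : ℝ → Euc n) (g : ℝ → ℝ) (z : ℝ × Euc n), y 0 = x ∧ g 0 = 0 ∧
      IsApproxTrajectory L ε (i * h) y g ∧ 0 < z.1 ∧
      g (i * h) + penalised W k (t - i * h, y (i * h)) z ≤ W (t, x) + 2 * η * (i * h) := by
  intro i
  induction i with
  | zero =>
    intro _
    refine ⟨fun _ => x, fun _ => 0, (t, x), rfl, rfl, ?_, ht, by simp [penalised]⟩
    intro s s' c p hs hss hs' _
    have h1 : s' = s := by simp at hs'; linarith
    simp [h1]
  | succ i ih =>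
    intro hi
    obtain ⟨y, g, z, hy0, hg0, hyg, hz0, hle⟩ := ih (by omega)
    have hiN : (i : ℝ) + 1 ≤ N := by exact_mod_cast hi
    have hih0 : 0 ≤ i * h := by positivity
    have hihT : i * h ≤ N * h := by gcongr; linarith
    have hg : 0 ≤ g (i * h) := by
      rw [← hg0]; exact hyg.mono_cost hL0 le_rfl hih0 le_rfl
    have h2 : 2 * η * (i * h) ≤ 2 * η * (N * h) := by gcongr
    obtain ⟨z', u, hz'0, hd, hu, hdesc⟩ := hstep (t - i * h, y (i * h)) z
      (by simp only; linarith) hz0 (by linarith)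
    have hdesc := hdesc h hh0.le
    have hT' : ((i + 1 : ℕ) : ℝ) * h = i * h + h := by push_cast; ring
    have m1 : min (i * h + h) (i * h) = i * h := min_eq_right (by linarith)
    have m2 : max (i * h + h - i * h) 0 = h := by rw [add_sub_cancel_left, max_eq_left hh0.le]
    rw [hT']
    refine ⟨_, _, z', ?_, ?_, hyg.extend (h := h) (z := z'.2) (u := u) ?_, hz'0, ?_⟩
    · simp only [min_eq_left hih0, hy0]
      rw [max_eq_right (by linarith)]; simp
    · simp only [min_eq_left hih0, hg0]
      rw [max_eq_right (by linarith)]; simp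
    · intro r hr
      rw [dist_comm, dist_eq_norm, add_sub_right_comm]
      refine (norm_add_le _ _).trans ?_
      have : ‖r • u‖ ≤ h * R := by
        rw [norm_smul, Real.norm_of_nonneg hr.1]
        exact mul_le_mul hr.2 hu (norm_nonneg _) hh0.le
      simp only at hd
      linarith
    · simp only [m1, m2]
      rw [← sub_sub]
      simp only at hdesc
      have := mul_le_mul_of_nonneg_left hh1 hh0.le
      nlinarith

theorem exists_approxTrajectory {n : ℕ} {L : Euc n → Euc n → ℝ} {Θ : Euc n → ℝ}
    {W : ℝ × Euc n → ℝ} (hL0 : ∀ x u, 0 ≤ L x u)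
    (hΘ0 : ∀ u, 0 ≤ Θ u) (hΘ : Superlinear Θ) (hcoer : ∀ x u, Θ u ≤ L x u)
    (hW0 : ∀ q : ℝ × Euc n, 0 < q.1 → 0 ≤ W q)
    (hWc : ContinuousOn W {q : ℝ × Euc n | 0 < q.1})
    (hsuper : ∀ t : ℝ, ∀ x : Euc n, 0 < t → ∀ p ∈ rsubdiffP W (t, x),
      (0 : EReal) ≤ (p.1 : ℝ) + Ham L x (-p.2))
    {t ε : ℝ} (x : Euc n) (hε : 0 < ε) (hεt : ε < t) :
    ∃ (T : ℝ) (y : ℝ → Euc n) (g : ℝ → ℝ) (z : ℝ × Euc n), t - ε ≤ T ∧ T ≤ t ∧ y 0 = x ∧ g 0 = 0 ∧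
      IsApproxTrajectory L ε T y g ∧ 0 < z.1 ∧ z.1 ≤ ε ∧ dist z.2 (y T) ≤ ε ∧
      g T + W z ≤ W (t, x) + ε := by
  have ht : 0 < t := hε.trans hεt
  have hWtx := hW0 (t, x) ht
  set T := t - ε / 2 with hT
  have hT0 : 0 < T := by linarith
  set D := ε / 4 with hD
  have hD0 : 0 < D := by positivity
  set C := W (t, x) + ε with hC
  set k := (C + 1) / D ^ 2 with hk
  have hk0 : 0 < k := by positivity
  have hCk : C < k * D ^ 2 := by
    rw [hk, div_mul_cancel₀ _ (by positivity)]; linarith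
  set η := ε / (2 * t) with hη
  have hη0 : 0 < η := by positivity
  have hηT : 2 * η * T ≤ ε := by
    rw [show ε = 2 * η * t by rw [hη]; field_simp]
    gcongr
    linarith
  obtain ⟨R, hR0, hstep⟩ := exists_descent_step hΘ0 hΘ hcoer hW0 hWc hsuper hk0 hD0 hCk hη0
  obtain ⟨N, hN⟩ := exists_nat_gt (T * k * (1 + R ^ 2) / η + T * R / D)
  have hN0 : (0 : ℝ) < N := lt_of_le_of_lt (by positivity) hN
  set h := T / N with hh
  have hh0 : 0 < h := by positivity
  have hNh : N * h = T := by rw [hh]; field_simp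
  have hh1 : k * h * (1 + R ^ 2) ≤ η := by
    have : T * k * (1 + R ^ 2) / η ≤ N := le_trans (le_add_of_nonneg_right (by positivity)) hN.le
    rw [div_le_iff₀ hη0] at this
    rw [hh, show k * (T / N) * (1 + R ^ 2) = T * k * (1 + R ^ 2) / N by ring, div_le_iff₀ hN0]
    linarith
  have hh2 : h * R ≤ D := by
    have : T * R / D ≤ N := le_trans (le_add_of_nonneg_left (by positivity)) hN.le
    rw [div_le_iff₀ hD0] at this
    rw [hh, show T / N * R = T * R / N by ring, div_le_iff₀ hN0]
    linarith
  obtain ⟨y, g, z, hy0, hg0, hyg, hz0, hle⟩ := exists_iterated_descent (ε := ε) (N := N) hL0 x ht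
    hh0 hη0 hstep (by linarith) (by rw [hNh]; linarith) hh1 (by linarith) N le_rfl
  rw [hNh] at hyg hle
  have hgT : 0 ≤ g T := by
    rw [← hg0]; exact hyg.mono_cost hL0 le_rfl hT0.le le_rfl
  have hJ : penalised W k (t - T, y T) z ≤ C := by linarith
  unfold penalised at hle hJ
  have hWz := hW0 z hz0
  have h2 : (t - T - z.1) ^ 2 + ‖y T - z.2‖ ^ 2 < D ^ 2 :=
    lt_of_mul_lt_mul_left (by simp only at hJ; linarith) hk0.le
  have h3 : |t - T - z.1| < D :=
    abs_lt_of_sq_lt_sq (by nlinarith [sq_nonneg ‖y T - z.2‖]) hD0.le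
  have h4 : ‖y T - z.2‖ < D :=
    lt_of_pow_lt_pow_left₀ 2 hD0.le (by nlinarith [sq_nonneg (t - T - z.1)])
  have h5 : 0 ≤ k * ((t - T - z.1) ^ 2 + ‖y T - z.2‖ ^ 2) := by positivity
  refine ⟨T, y, g, z, by linarith, by linarith, hy0, hg0, hyg, hz0, ?_, ?_, ?_⟩
  · linarith [(abs_lt.1 h3).1]
  · rw [dist_comm, dist_eq_norm]; linarith
  · simp only at hle; linarith

/-- Disjoint intervals contribute at most the total increment of a monotone function. -/
theorem MonotoneOn.sum_dist_le {g : ℝ → ℝ} {a b : ℝ} (hab : a ≤ b)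
    (hg : MonotoneOn g (Icc a b)) {E : ℕ × (ℕ → ℝ × ℝ)}
    (hE : E ∈ AbsolutelyContinuousOnInterval.disjWithin a b) :
    ∑ i ∈ Finset.range E.1, dist (g (E.2 i).1) (g (E.2 i).2) ≤ g b - g a := by
  obtain ⟨hmem, hdisj⟩ := hE
  rw [uIcc_of_le hab] at hmem
  have key : ∀ u ∈ Icc a b, ∀ v ∈ Icc a b, ∀ r, r ∈ uIoc (g u) (g v) →
      g (min u v) < r ∧ r ≤ g (max u v) := by
    intro u hu v hv r hr
    rcases le_total u v with h | h
    · rw [uIoc_of_le (hg hu hv h)] at hr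
      simpa [h] using hr
    · rw [uIoc_of_ge (hg hv hu h)] at hr
      simpa [h] using hr
  have hgd : (↑(Finset.range E.1) : Set ℕ).PairwiseDisjoint
      fun i => uIoc (g (E.2 i).1) (g (E.2 i).2) := by
    intro i hi j hj hij
    rw [Function.onFun, Set.disjoint_left]
    intro r hri hrj
    obtain ⟨hi1, hi2⟩ := hmem i hi
    obtain ⟨hj1, hj2⟩ := hmem j hj
    obtain ⟨i3, i4⟩ := key _ hi1 _ hi2 r hri
    obtain ⟨j3, j4⟩ := key _ hj1 _ hj2 r hrj
    have h1 := hdisj hi hj hij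
    simp only [Function.onFun, uIoc] at h1
    rw [Ioc_disjoint_Ioc] at h1
    have mem_min : ∀ u ∈ Icc a b, ∀ v ∈ Icc a b, min u v ∈ Icc a b := fun u hu v hv =>
      ⟨le_min hu.1 hv.1, (min_le_left _ _).trans hu.2⟩
    have mem_max : ∀ u ∈ Icc a b, ∀ v ∈ Icc a b, max u v ∈ Icc a b := fun u hu v hv =>
      ⟨hu.1.trans (le_max_left _ _), max_le hu.2 hv.2⟩
    have h2 := hg (mem_min _ (mem_max _ hi1 _ hi2) _ (mem_max _ hj1 _ hj2))
      (mem_max _ (mem_min _ hi1 _ hi2) _ (mem_min _ hj1 _ hj2)) h1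
    rcases min_choice (max (E.2 i).1 (E.2 i).2) (max (E.2 j).1 (E.2 j).2) with h | h <;>
    rcases max_choice (min (E.2 i).1 (E.2 i).2) (min (E.2 j).1 (E.2 j).2) with h' | h' <;>
    rw [h, h'] at h2 <;> linarith
  have hsub : (⋃ i ∈ Finset.range E.1, uIoc (g (E.2 i).1) (g (E.2 i).2)) ⊆ Ioc (g a) (g b) := by
    simp only [iUnion_subset_iff]
    intro i hi
    have ha : a ∈ Icc a b := ⟨le_rfl, hab⟩
    have hb : b ∈ Icc a b := ⟨hab, le_rfl⟩
    obtain ⟨h1, h2⟩ := hmem i hi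
    exact Ioc_subset_Ioc (le_min (hg ha h1 h1.1) (hg ha h2 h2.1))
      (max_le (hg h1 hb h1.2) (hg h2 hb h2.2))
  have hvol := MeasureTheory.measure_mono (μ := MeasureTheory.volume) hsub
  rw [MeasureTheory.measure_biUnion_finset hgd (fun i _ => measurableSet_uIoc),
    Real.volume_Ioc] at hvol
  have hterm : ∀ i, MeasureTheory.volume (uIoc (g (E.2 i).1) (g (E.2 i).2)) =
      ENNReal.ofReal (dist (g (E.2 i).1) (g (E.2 i).2)) := by
    intro i
    rw [uIoc, Real.volume_Ioc, max_sub_min_eq_abs', Real.dist_eq]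
  simp only [hterm] at hvol
  rw [← ENNReal.ofReal_sum_of_nonneg (fun _ _ => dist_nonneg)] at hvol
  exact (ENNReal.ofReal_le_ofReal_iff
    (sub_nonneg.2 (hg ⟨le_rfl, hab⟩ ⟨hab, le_rfl⟩ hab))).1 hvol

/-- A function whose increments are superlinearly controlled by those of a monotone function is
absolutely continuous. -/
theorem absolutelyContinuousOnInterval_of_superlinear_bound {X : Type*} [PseudoMetricSpace X]
    {f : ℝ → X} {g : ℝ → ℝ} {a b : ℝ} (hab : a ≤ b) (hg : MonotoneOn g (Icc a b))
    (hfg : ∀ K > 0, ∃ R, 0 ≤ R ∧ ∀ s s', a ≤ s → s ≤ s' → s' ≤ b →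
      K * dist (f s) (f s') ≤ K * R * (s' - s) + (g s' - g s)) :
    AbsolutelyContinuousOnInterval f a b := by
  rw [absolutelyContinuousOnInterval_iff]
  intro ε hε
  have hgab : 0 ≤ g b - g a := sub_nonneg.2 (hg ⟨le_rfl, hab⟩ ⟨hab, le_rfl⟩ hab)
  set K := 2 * (g b - g a + 1) / ε with hK
  have hK0 : 0 < K := by positivity
  obtain ⟨R, hR0, hR⟩ := hfg K hK0
  refine ⟨ε / (2 * (R + 1)), by positivity, fun E hE hlen => ?_⟩
  have hmem := hE.1
  rw [uIcc_of_le hab] at hmem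
  have hterm : ∀ u ∈ Icc a b, ∀ v ∈ Icc a b,
      K * dist (f u) (f v) ≤ K * R * dist u v + dist (g u) (g v) := by
    have aux : ∀ u ∈ Icc a b, ∀ v ∈ Icc a b, u ≤ v →
        K * dist (f u) (f v) ≤ K * R * dist u v + dist (g u) (g v) := by
      intro u hu v hv huv
      have h1 := hR u v hu.1 huv hv.2
      rw [dist_comm u v, dist_comm (g u) (g v), Real.dist_eq v, Real.dist_eq (g v)]
      have h2 := mul_le_mul_of_nonneg_left (le_abs_self (v - u)) (mul_nonneg hK0.le hR0)
      linarith [le_abs_self (g v - g u)]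
    intro u hu v hv
    rcases le_total u v with h | h
    · exact aux u hu v hv h
    · rw [dist_comm (f u), dist_comm u, dist_comm (g u)]
      exact aux v hv u hu h
  have hsum : K * ∑ i ∈ Finset.range E.1, dist (f (E.2 i).1) (f (E.2 i).2) ≤
      K * R * (∑ i ∈ Finset.range E.1, dist (E.2 i).1 (E.2 i).2) + (g b - g a) := by
    refine le_trans ?_ (add_le_add_right (hg.sum_dist_le hab hE) _)
    rw [Finset.mul_sum, Finset.mul_sum, ← Finset.sum_add_distrib]
    exact Finset.sum_le_sum fun i hi => hterm _ (hmem i hi).1 _ (hmem i hi).2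
  have h3 : R * (∑ i ∈ Finset.range E.1, dist (E.2 i).1 (E.2 i).2) ≤ ε / 2 := by
    refine (mul_le_mul_of_nonneg_left hlen.le hR0).trans ?_
    rw [mul_div_assoc', div_le_div_iff₀ (by positivity) two_pos]
    nlinarith
  have h4 : K * (ε / 2) = g b - g a + 1 := by rw [hK]; field_simp
  refine lt_of_mul_lt_mul_left ?_ hK0.le
  nlinarith [mul_le_mul_of_nonneg_left h3 hK0.le]

/-- The fundamental theorem of calculus for absolutely continuous curves in Euclidean space. -/
theorem exists_integrable_derivative {n : ℕ} {y : ℝ → Euc n} {t : ℝ} (ht : 0 ≤ t)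
    (hy : ∀ i, AbsolutelyContinuousOnInterval (fun s => y s i) 0 t) :
    ∃ u : ℝ → Euc n, IntervalIntegrable u MeasureTheory.volume 0 t ∧
      (∀ s ∈ Icc 0 t, y s = y 0 + ∫ r in (0 : ℝ)..s, u r) ∧
      ∀ᵐ s, s ∈ Icc 0 t → HasDerivAt y (u s) s := by
  have hrepr : ∀ v : Euc n, ∑ i, v i • EuclideanSpace.basisFun (Fin n) ℝ i = v := fun v => by
    simpa using (EuclideanSpace.basisFun (Fin n) ℝ).sum_repr v
  have hsub : ∀ s ∈ Icc 0 t, uIcc 0 s ⊆ uIcc 0 t := fun s hs => by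
    rw [uIcc_of_le hs.1, uIcc_of_le ht]
    exact Icc_subset_Icc_right hs.2
  have hInt : ∀ s ∈ Icc 0 t, ∀ i, IntervalIntegrable (fun s => deriv (fun r => y r i) s •
      EuclideanSpace.basisFun (Fin n) ℝ i) MeasureTheory.volume 0 s := fun s hs i =>
    have h := ((hy i).mono (hsub s hs)).intervalIntegrable_deriv
    ⟨MeasureTheory.Integrable.smul_const h.1 _, MeasureTheory.Integrable.smul_const h.2 _⟩
  refine ⟨fun s => ∑ i, deriv (fun r => y r i) s • EuclideanSpace.basisFun (Fin n) ℝ i,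
    ?_, ?_, ?_⟩
  · exact ⟨MeasureTheory.integrable_finsetSum _ fun i _ => (hInt t ⟨ht, le_rfl⟩ i).1,
      MeasureTheory.integrable_finsetSum _ fun i _ => (hInt t ⟨ht, le_rfl⟩ i).2⟩
  · intro s hs
    rw [intervalIntegral.integral_finsetSum fun i _ => hInt s hs i]
    simp only [intervalIntegral.integral_smul_const]
    simp only [((hy _).mono (hsub s hs)).integral_deriv_eq_sub, sub_smul, Finset.sum_sub_distrib, hrepr]
    abel
  · have h1 : ∀ᵐ s, ∀ i, s ∈ uIcc 0 t → DifferentiableAt ℝ (fun r => y r i) s :=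
      MeasureTheory.ae_all_iff.2 fun i => (hy i).ae_differentiableAt
    filter_upwards [h1] with s hs hst
    rw [uIcc_of_le ht] at hs
    have h2 := HasDerivAt.fun_sum (u := Finset.univ) fun i _ =>
      ((hs i hst).hasDerivAt.smul_const (EuclideanSpace.basisFun (Fin n) ℝ i))
    simpa only [hrepr] using h2

theorem le_deriv_of_minorants {n : ℕ} {L : Euc n → Euc n → ℝ} {Θ : Euc n → ℝ}
    (hLc : Continuous (fun q : Euc n × Euc n => L q.1 q.2))
    (hconv : ∀ x, ConvexOn ℝ Set.univ (L x))
    (hΘ0 : ∀ u, 0 ≤ Θ u) (hΘ : Superlinear Θ) (hcoer : ∀ x u, Θ u ≤ L x u)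
    {y : ℝ → Euc n} {g : ℝ → ℝ} {s d : ℝ} {v : Euc n}
    (hy : HasDerivAt y v s) (hg : HasDerivAt g d s)
    (hloc : ∀ (c : ℝ) (p : Euc n), ∀ ρ > 0,
      (∀ x, dist x (y s) ≤ ρ → ∀ w, c + ⟪p, w⟫ ≤ L x w) →
      ∀ᶠ s' in 𝓝[>] s, c * (s' - s) + ⟪p, y s' - y s⟫ ≤ g s' - g s) :
    L (y s) v ≤ d := by
  by_contra! hlt
  obtain ⟨a, hda, haL⟩ := exists_between hlt
  obtain ⟨c, p, hcp, hval⟩ := exists_affine_minorant (hconv (y s))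
    (hLc.comp (Continuous.prodMk_right (y s))) v haL
  obtain ⟨ρ, hρ, hstab⟩ := affine_minorant_stable hLc hΘ0 hΘ hcoer
    (half_pos (sub_pos.2 hda)) hcp
  have hle : 𝓝[>] s ≤ 𝓝[≠] s := nhdsWithin_mono _ fun r hr => ne_of_gt hr
  have hys := (hasDerivAt_iff_tendsto_slope.1 hy).mono_left hle
  have hgs := (hasDerivAt_iff_tendsto_slope.1 hg).mono_left hle
  have hlim : c - (a - d) / 2 + ⟪p, v⟫ ≤ d := by
    refine le_of_tendsto_of_tendsto (tendsto_const_nhds.add (tendsto_const_nhds.inner hys)) hgs ?_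
    filter_upwards [hloc _ p ρ hρ hstab, self_mem_nhdsWithin] with s' hs' hpos
    have hpos' : 0 < s' - s := sub_pos.2 hpos
    rw [slope_def_module, slope_def_module, inner_smul_right, smul_eq_mul]
    calc _ = (s' - s)⁻¹ * ((c - (a - d) / 2) * (s' - s) + ⟪p, y s' - y s⟫) := by
          field_simp
      _ ≤ _ := mul_le_mul_of_nonneg_left hs' (inv_nonneg.2 hpos'.le)
  linarith

/-- A curve whose increments are controlled by those of the monotone cost `g` is an admissible
trajectory, and `g` dominates its Bolza cost. -/
theorem exists_control_of_minorants {n : ℕ} {L : Euc n → Euc n → ℝ} {Θ : Euc n → ℝ}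
    (hL0 : ∀ x u, 0 ≤ L x u)
    (hLc : Continuous (fun q : Euc n × Euc n => L q.1 q.2))
    (hconv : ∀ x, ConvexOn ℝ Set.univ (L x))
    (hΘ0 : ∀ u, 0 ≤ Θ u) (hΘ : Superlinear Θ) (hcoer : ∀ x u, Θ u ≤ L x u)
    {y : ℝ → Euc n} {g : ℝ → ℝ} {t : ℝ} (ht : 0 ≤ t) (hg : MonotoneOn g (Icc 0 t))
    (hac : ∀ K > 0, ∃ R, 0 ≤ R ∧ ∀ s s', 0 ≤ s → s ≤ s' → s' ≤ t →
      K * ‖y s' - y s‖ ≤ K * R * (s' - s) + (g s' - g s))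
    (hloc : ∀ s ∈ Ico 0 t, ∀ (c : ℝ) (p : Euc n), ∀ ρ > 0,
      (∀ x, dist x (y s) ≤ ρ → ∀ w, c + ⟪p, w⟫ ≤ L x w) →
      ∀ᶠ s' in 𝓝[>] s, c * (s' - s) + ⟪p, y s' - y s⟫ ≤ g s' - g s) :
    ∃ u : ℝ → Euc n, IntervalIntegrable u MeasureTheory.volume 0 t ∧
      (∀ s ∈ Icc 0 t, y s = y 0 + ∫ r in (0 : ℝ)..s, u r) ∧
      IntervalIntegrable (fun s => L (y 0 + ∫ r in (0 : ℝ)..s, u r) (u s))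
        MeasureTheory.volume 0 t ∧
      ∫ s in (0 : ℝ)..t, L (y 0 + ∫ r in (0 : ℝ)..s, u r) (u s) ≤ g t - g 0 := by
  obtain ⟨u, hu, hyu, hder⟩ := exists_integrable_derivative (y := y) ht fun i =>
    absolutelyContinuousOnInterval_of_superlinear_bound ht hg fun K hK => by
      obtain ⟨R, hR0, hR⟩ := hac K hK
      refine ⟨R, hR0, fun s s' h1 h2 h3 => le_trans ?_ (hR s s' h1 h2 h3)⟩
      refine mul_le_mul_of_nonneg_left ?_ (le_of_lt hK)
      rw [dist_comm, Real.dist_eq, ← PiLp.sub_apply, ← Real.norm_eq_abs]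
      exact PiLp.norm_apply_le _ i
  have hg' : MonotoneOn g (uIcc 0 t) := by rwa [uIcc_of_le ht]
  have hbound : ∀ᵐ s ∂(MeasureTheory.volume.restrict (Ioc 0 t)),
      L (y 0 + ∫ r in (0 : ℝ)..s, u r) (u s) ≤ deriv g s := by
    rw [MeasureTheory.ae_restrict_iff' measurableSet_Ioc]
    filter_upwards [hder, hg.ae_differentiableWithinAt_of_mem,
      MeasureTheory.Measure.ae_ne MeasureTheory.volume t] with s h1 h2 h3 hs
    have hst : s < t := lt_of_le_of_ne hs.2 h3
    have hs' : s ∈ Icc 0 t := Ioc_subset_Icc_self hs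
    rw [← hyu s hs']
    exact le_deriv_of_minorants hLc hconv hΘ0 hΘ hcoer (h1 hs')
      ((h2 hs').differentiableAt (Icc_mem_nhds hs.1 hst)).hasDerivAt (hloc s ⟨hs.1.le, hst⟩)
  have hLint : IntervalIntegrable (fun s => L (y 0 + ∫ r in (0 : ℝ)..s, u r) (u s))
      MeasureTheory.volume 0 t := by
    rw [intervalIntegrable_iff_integrableOn_Ioc_of_le ht]
    refine MeasureTheory.Integrable.mono' (hg'.intervalIntegrable_deriv.1) ?_ ?_
    · have hprim : ContinuousOn (fun s => ∫ r in (0 : ℝ)..s, u r) (Ioc 0 t) := by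
        refine (intervalIntegral.continuousOn_primitive_interval (a := 0) (b := t) ?_).mono ?_
        · rw [uIcc_of_le ht, integrableOn_Icc_iff_integrableOn_Ioc]
          exact hu.1
        · rw [uIcc_of_le ht]; exact Ioc_subset_Icc_self
      exact hLc.comp_aestronglyMeasurable
        (((continuousOn_const.add hprim).aestronglyMeasurable measurableSet_Ioc).prodMk
          hu.1.aestronglyMeasurable)
    · filter_upwards [hbound] with s hs
      rwa [Real.norm_of_nonneg (hL0 _ _)]
  refine ⟨u, hu, hyu, hLint, ?_⟩
  have h1 := hg'.intervalIntegral_deriv_mem_uIcc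
  rw [uIcc_of_le (sub_nonneg.2 (hg ⟨le_rfl, ht⟩ ⟨ht, le_rfl⟩ ht))] at h1
  refine le_trans ?_ h1.2
  rw [intervalIntegral.integral_of_le ht, intervalIntegral.integral_of_le ht]
  exact MeasureTheory.integral_mono_ae hLint.1 hg'.intervalIntegrable_deriv.1 hbound

theorem Ultrafilter.exists_tendsto_of_forall_mem {ι X : Type*} [TopologicalSpace X]
    (F : Ultrafilter ι) {K : Set X} (hK : IsCompact K) {f : ι → X} (hf : ∀ i, f i ∈ K) :
    ∃ x ∈ K, Tendsto f F (𝓝 x) :=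
  hK.ultrafilter_le_nhds (F.map f) (le_principal_iff.2 (Filter.mem_map.2 (univ_mem' hf)))

/-- Approximate trajectories of a supersolution converge, along an ultrafilter, to a curve along
which the supersolution decreases at least as fast as the cost grows. -/
theorem exists_limit_trajectory {n : ℕ} {L : Euc n → Euc n → ℝ} {Θ : Euc n → ℝ}
    {W : ℝ × Euc n → ℝ} (hL0 : ∀ x u, 0 ≤ L x u)
    (hΘ0 : ∀ u, 0 ≤ Θ u) (hΘ : Superlinear Θ) (hcoer : ∀ x u, Θ u ≤ L x u)
    (hW0 : ∀ q : ℝ × Euc n, 0 < q.1 → 0 ≤ W q)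
    (hWc : ContinuousOn W {q : ℝ × Euc n | 0 < q.1})
    (hsuper : ∀ t : ℝ, ∀ x : Euc n, 0 < t → ∀ p ∈ rsubdiffP W (t, x),
      (0 : EReal) ≤ (p.1 : ℝ) + Ham L x (-p.2))
    {t : ℝ} (ht : 0 < t) (x : Euc n) :
    ∃ (y : ℝ → Euc n) (g : ℝ → ℝ), y 0 = x ∧ g 0 = 0 ∧ MonotoneOn g (Icc 0 t) ∧
      (∀ K > 0, ∃ R, 0 ≤ R ∧ ∀ s s', 0 ≤ s → s ≤ s' → s' ≤ t →
        K * ‖y s' - y s‖ ≤ K * R * (s' - s) + (g s' - g s)) ∧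
      (∀ s ∈ Ico 0 t, ∀ (c : ℝ) (p : Euc n), ∀ ρ > 0,
        (∀ x, dist x (y s) ≤ ρ → ∀ w, c + ⟪p, w⟫ ≤ L x w) →
        ∀ᶠ s' in 𝓝[>] s, c * (s' - s) + ⟪p, y s' - y s⟫ ≤ g s' - g s) ∧
      ∀ a, (∀ᶠ z in (𝓝[>] (0 : ℝ)) ×ˢ 𝓝 (y t), a ≤ W z) → g t + a ≤ W (t, x) := by
  set e : ℕ → ℝ := fun m => t / (m + 2) with he
  have he0 : ∀ m, 0 < e m := fun m => by positivity
  have het : ∀ m, e m < t := fun m => by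
    refine div_lt_self ht ?_
    have : (0 : ℝ) ≤ m := m.cast_nonneg
    linarith
  choose T Y G z hT1 hT2 hY0 hG0 hYG hz0 hz1 hz2 hfin using fun m =>
    exists_approxTrajectory hL0 hΘ0 hΘ hcoer hW0 hWc hsuper x (he0 m) (het m)
  have hT0 : ∀ m, 0 ≤ T m := fun m => by linarith [hT1 m, het m]
  set F : Ultrafilter ℕ := hyperfilter ℕ
  have heF : Tendsto e F (𝓝 0) := by
    refine Tendsto.mono_left ?_ Nat.hyperfilter_le_atTop
    exact tendsto_const_nhds.div_atTop
      (tendsto_atTop_add_const_right _ _ tendsto_natCast_atTop_atTop)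
  set C := W (t, x) + t with hC
  have hGle : ∀ m s, 0 ≤ s → s ≤ T m → G m s ≤ C := fun m s h0 hs => by
    have h1 := (hYG m).mono_cost hL0 h0 hs le_rfl
    linarith [hfin m, hW0 _ (hz0 m), het m]
  have hGnn : ∀ m s, 0 ≤ s → s ≤ T m → 0 ≤ G m s := fun m s h0 hs =>
    (hG0 m).symm.le.trans ((hYG m).mono_cost hL0 le_rfl h0 hs)
  have hmin : ∀ m s, 0 ≤ s → 0 ≤ min s (T m) := fun m s hs => le_min hs (hT0 m)
  have hincr : ∀ K > 0, ∃ R, 0 ≤ R ∧ ∀ m s s', 0 ≤ s → s ≤ s' → s' ≤ T m →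
      K * ‖Y m s' - Y m s‖ ≤ K * R * (s' - s) + (G m s' - G m s) := fun K hK => by
    obtain ⟨R, hR0, hR⟩ := hΘ.exists_bound hΘ0 hK
    exact ⟨R, hR0, fun m s s' h1 h2 h3 => (hYG m).norm_sub_le hcoer hK hR h1 h2 h3⟩
  obtain ⟨R₁, hR₁0, hR₁⟩ := hincr 1 one_pos
  have hYlim : ∀ s, ∃ v, 0 ≤ s → Tendsto (fun m => Y m (min s (T m))) F (𝓝 v) := fun s => by
    by_cases hs : 0 ≤ s
    · obtain ⟨v, -, hv⟩ := F.exists_tendsto_of_forall_mem (isCompact_closedBall x (R₁ * t + C))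
        (f := fun m => Y m (min s (T m))) fun m => by
          have h1 := hR₁ m 0 _ le_rfl (hmin m s hs) (min_le_right _ _)
          have h2 := hGle m _ (hmin m s hs) (min_le_right _ _)
          have h3 : R₁ * min s (T m) ≤ R₁ * t :=
            mul_le_mul_of_nonneg_left ((min_le_right _ _).trans (hT2 m)) hR₁0
          rw [hY0, hG0] at h1
          rw [mem_closedBall, dist_eq_norm]
          linarith
      exact ⟨v, fun _ => hv⟩
    · exact ⟨0, fun h => absurd h hs⟩
  have hGlim : ∀ s, ∃ v, 0 ≤ s → Tendsto (fun m => G m (min s (T m))) F (𝓝 v) := fun s => by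
    by_cases hs : 0 ≤ s
    · obtain ⟨v, -, hv⟩ := F.exists_tendsto_of_forall_mem (isCompact_Icc (a := 0) (b := C))
        (f := fun m => G m (min s (T m))) fun m =>
          ⟨hGnn m _ (hmin m s hs) (min_le_right _ _), hGle m _ (hmin m s hs) (min_le_right _ _)⟩
      exact ⟨v, fun _ => hv⟩
    · exact ⟨0, fun h => absurd h hs⟩
  choose y hy using hYlim
  choose g hg using hGlim
  have heps : ∀ δ > 0, ∀ᶠ m in (F : Filter ℕ), e m < δ := fun δ hδ => heF.eventually_lt_const hδ
  refine ⟨y, g, ?_, ?_, ?_, ?_, ?_, ?_⟩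
  · refine tendsto_nhds_unique (hy 0 le_rfl) (tendsto_const_nhds.congr fun m => ?_)
    rw [min_eq_left (hT0 m), hY0]
  · refine tendsto_nhds_unique (hg 0 le_rfl) (tendsto_const_nhds.congr fun m => ?_)
    rw [min_eq_left (hT0 m), hG0]
  · intro s hs s' hs' hss
    exact le_of_tendsto_of_tendsto' (hg s hs.1) (hg s' hs'.1) fun m =>
      (hYG m).mono_cost hL0 (hmin m s hs.1) (min_le_min_right _ hss) (min_le_right _ _)
  · intro K hK
    obtain ⟨R, hR0, hR⟩ := hincr K hK
    refine ⟨R, hR0, fun s s' h0 hss hs' => ?_⟩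
    refine le_of_tendsto_of_tendsto'
      (((hy s' (h0.trans hss)).sub (hy s h0)).norm.const_mul K)
      (((hg s' (h0.trans hss)).sub (hg s h0)).const_add (K * R * (s' - s))) fun m => ?_
    refine (hR m _ _ (hmin m s h0) (min_le_min_right _ hss) (min_le_right _ _)).trans ?_
    have h1 : min s' (T m) - min s (T m) ≤ s' - s := by
      rcases le_total s (T m) with h | h
      · rw [min_eq_left h]; linarith [min_le_left s' (T m)]
      · rw [min_eq_right h]; linarith [min_le_right s' (T m)]
    have h2 := mul_le_mul_of_nonneg_left h1 (mul_nonneg hK.le hR0)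
    linarith
  · intro s hs c p ρ hρ hminor
    have hC0 : 0 ≤ C := (hGnn 0 0 le_rfl (hT0 0)).trans (hGle 0 0 le_rfl (hT0 0))
    set K := 4 * (C + 1) / ρ with hKdef
    have hK0 : 0 < K := by positivity
    have hCK : C < K * (ρ / 4) := by
      have : K * (ρ / 4) = C + 1 := by rw [hKdef]; field_simp
      linarith
    obtain ⟨R, hR0, hR⟩ := hincr K hK0
    have hlt : s < min t (s + ρ / (4 * (R + 1))) :=
      lt_min hs.2 (lt_add_of_pos_right _ (by positivity))
    filter_upwards [Ioo_mem_nhdsGT hlt] with s' hs'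
    have hs't : s' < t := hs'.2.trans_le (min_le_left _ _)
    have hs'0 : 0 ≤ s' := hs.1.trans hs'.1.le
    have hRs : R * (s' - s) ≤ ρ / 4 := by
      have h1 : s' - s ≤ ρ / (4 * (R + 1)) := by
        linarith [hs'.2.trans_le (min_le_right t (s + ρ / (4 * (R + 1))))]
      refine (mul_le_mul_of_nonneg_left h1 hR0).trans ?_
      rw [mul_div_assoc', div_le_div_iff₀ (by positivity) (by norm_num)]
      nlinarith
    refine le_of_tendsto_of_tendsto (tendsto_const_nhds.add
      (tendsto_const_nhds.inner ((hy s' hs'0).sub (hy s hs.1)))) ((hg s' hs'0).sub (hg s hs.1)) ?_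
    filter_upwards [heps (t - s') (sub_pos.2 hs't), heps (ρ / 4) (by positivity),
      (hy s hs.1) (ball_mem_nhds (y s) (show 0 < ρ / 4 by positivity))] with m h1 h2 h3
    have hTs' : s' ≤ T m := by linarith [hT1 m]
    have hTs : s ≤ T m := hs'.1.le.trans hTs'
    simp only [mem_preimage, mem_ball, min_eq_left hTs] at h3
    rw [min_eq_left hTs', min_eq_left hTs]
    refine hYG m s s' c p hs.1 hs'.1.le hTs' fun r hr v hv => hminor v ?_
    have h4 := hR m s r hs.1 hr.1 (hr.2.trans hTs')
    have h5 := hGle m r (hs.1.trans hr.1) (hr.2.trans hTs')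
    have h6 := hGnn m s hs.1 hTs
    have h7 : ‖Y m r - Y m s‖ ≤ ρ / 2 := by
      refine le_of_mul_le_mul_left ?_ hK0
      have h8 : R * (r - s) ≤ ρ / 4 :=
        (mul_le_mul_of_nonneg_left (by linarith [hr.2]) hR0).trans hRs
      nlinarith [mul_le_mul_of_nonneg_left h8 hK0.le]
    rw [← dist_eq_norm] at h7
    linarith [dist_triangle4 v (Y m r) (Y m s) (y s)]
  · intro a ha
    have hmint : ∀ m, min t (T m) = T m := fun m => min_eq_right (hT2 m)
    have hyt := hy t ht.le
    have hgt := hg t ht.le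
    simp only [hmint] at hyt hgt
    have hzlim : Tendsto z F ((𝓝[>] (0 : ℝ)) ×ˢ 𝓝 (y t)) := by
      refine Tendsto.prodMk (tendsto_nhdsWithin_iff.2 ⟨?_, Eventually.of_forall hz0⟩) ?_
      · exact squeeze_zero (fun m => (hz0 m).le) hz1 heF
      · refine (tendsto_iff_of_dist ?_).2 hyt
        exact squeeze_zero (fun _ => dist_nonneg) hz2 heF
    have h1 : Tendsto (fun m => W (t, x) + e m) F (𝓝 (W (t, x))) := by
      simpa using heF.const_add (W (t, x))
    refine le_of_tendsto_of_tendsto (hgt.add_const a) h1 ?_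
    filter_upwards [hzlim.eventually ha] with m hm
    linarith [hfin m]

/-- A supersolution dominates the value function. -/
theorem bolzaValue_le_of_supersolution {n : ℕ} {L : Euc n → Euc n → ℝ} {Θ : Euc n → ℝ}
    {φ : Euc n → EReal} {W : ℝ × Euc n → ℝ} (hL0 : ∀ x u, 0 ≤ L x u)
    (hLc : Continuous (fun q : Euc n × Euc n => L q.1 q.2))
    (hconv : ∀ x, ConvexOn ℝ Set.univ (L x))
    (hΘ0 : ∀ u, 0 ≤ Θ u) (hΘ : Superlinear Θ) (hcoer : ∀ x u, Θ u ≤ L x u)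
    (hW0 : ∀ q : ℝ × Euc n, 0 < q.1 → 0 ≤ W q)
    (hWc : ContinuousOn W {q : ℝ × Euc n | 0 < q.1})
    (hinit : ∀ x : Euc n,
      φ x ≤ Filter.liminf (fun z : ℝ × Euc n => ((W z : ℝ) : EReal)) ((𝓝[>] (0:ℝ)) ×ˢ 𝓝 x))
    (hsuper : ∀ t : ℝ, ∀ x : Euc n, 0 < t → ∀ p ∈ rsubdiffP W (t, x),
      (0 : EReal) ≤ (p.1 : ℝ) + Ham L x (-p.2))
    {t : ℝ} (ht : 0 < t) (x : Euc n) :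
    bolzaValue L φ t x ≤ ((W (t, x) : ℝ) : EReal) := by
  obtain ⟨y, g, hy0, hg0, hmono, hac, hloc, hend⟩ :=
    exists_limit_trajectory hL0 hΘ0 hΘ hcoer hW0 hWc hsuper ht x
  obtain ⟨u, hu, hyu, hLu, hcost⟩ :=
    exists_control_of_minorants hL0 hLc hconv hΘ0 hΘ hcoer ht.le hmono hac hloc
  rw [hy0] at hyu hLu hcost
  rw [hg0, sub_zero] at hcost
  have hφ : φ (y t) ≤ ((W (t, x) - g t : ℝ) : EReal) := by
    by_contra! hlt
    obtain ⟨a, ha1, ha2⟩ := EReal.lt_iff_exists_real_btwn.1 (hlt.trans_le (hinit (y t)))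
    have h1 := hend a ((eventually_lt_of_lt_liminf ha2).mono fun z hz =>
      (EReal.coe_lt_coe_iff.1 hz).le)
    rw [EReal.coe_lt_coe_iff] at ha1
    linarith
  have hmem : bolzaValue L φ t x ≤ _ := sInf_le ⟨u, hu, hLu, rfl⟩
  refine hmem.trans ?_
  rw [← hyu t ⟨ht.le, le_rfl⟩]
  calc _ ≤ ((g t : ℝ) : EReal) + ((W (t, x) - g t : ℝ) : EReal) :=
        add_le_add (EReal.coe_le_coe_iff.2 hcost) hφ
    _ = _ := by rw [← EReal.coe_add]; congr 1; ring

theorem ConvexOn.mul_apply_inv_smul_le {E : Type*} [AddCommGroup E] [Module ℝ E] {f : E → ℝ}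
    (hf : ConvexOn ℝ univ f) {a : ℝ} (ha : 1 ≤ a) (v : E) :
    a * f (a⁻¹ • v) ≤ f v + (a - 1) * f 0 := by
  have ha0 : 0 < a := by linarith
  have h := hf.2 (mem_univ v) (mem_univ 0) (inv_nonneg.2 ha0.le)
    (sub_nonneg.2 (inv_le_one_of_one_le₀ ha)) (by ring)
  rw [smul_zero, add_zero, smul_eq_mul, smul_eq_mul] at h
  calc a * f (a⁻¹ • v) ≤ a * (a⁻¹ * f v + (1 - a⁻¹) * f 0) :=
        mul_le_mul_of_nonneg_left h ha0.le
    _ = f v + (a - 1) * f 0 := by field_simp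

/-- Comparison of a subsolution at the endpoints of a short arc of a trajectory, replaced by the
chord run through at the reparametrised speed `u / a`. -/
theorem le_along_short_arc {n : ℕ} {L : Euc n → Euc n → ℝ} {W : ℝ × Euc n → ℝ}
    (hLc : Continuous (fun q : Euc n × Euc n => L q.1 q.2))
    (hconv : ∀ x, ConvexOn ℝ Set.univ (L x))
    (hWc : ContinuousOn W {q : ℝ × Euc n | 0 < q.1})
    (hsub : ∀ t : ℝ, ∀ x : Euc n, 0 < t → ∀ p ∈ rsupdiffP W (t, x),
      (p.1 : ℝ) + Ham L x (-p.2) ≤ (0 : EReal))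
    {y u : ℝ → Euc n} {a : ℝ → ℝ} {s s' R M η δ τ : ℝ} {d : Euc n} (hss : s < s') (hη : 0 < η)
    (hu : IntervalIntegrable u MeasureTheory.volume s s')
    (ha : IntervalIntegrable a MeasureTheory.volume s s')
    (hLu : IntervalIntegrable (fun r => L (y r) (u r)) MeasureTheory.volume s s')
    (hy : y s' - y s = ∫ r in s..s', u r)
    (ha1 : ∀ r, 1 ≤ a r) (haR : ∀ r, ‖u r‖ ≤ R * a r)
    (hM : ∀ r ∈ Icc s s', L (y r) 0 ≤ M)
    (hnear : ∀ r ∈ Icc s s', ∀ v, ‖v‖ ≤ R → L (y s) v ≤ L (y r) v + η)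
    (hball : ∀ z, dist z (y s) ≤ δ → ∀ v, ‖v‖ ≤ R → L z v ≤ L (y s) v + η)
    (hd : ‖d‖ + ‖y s' - y s‖ ≤ δ) (hτ : ∫ r in s..s', a r < τ) :
    W (τ, y s + d) ≤ (∫ r in s..s', (L (y r) (u r) + (a r - 1) * M + 4 * η * a r)) +
      W (τ - ∫ r in s..s', a r, y s' + d) := by
  set A := ∫ r in s..s', a r with hA
  have hInt := intervalIntegral.integral_mono_on hss.le intervalIntegrable_const ha
    fun r _ => ha1 r
  have hA0 : 0 < A := by
    rw [intervalIntegral.integral_const, smul_eq_mul, mul_one] at hInt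
    linarith
  set v := A⁻¹ • (y s' - y s) with hv
  have hAv : A • v = y s' - y s := smul_inv_smul₀ hA0.ne' _
  have hvR : ‖v‖ ≤ R := by
    have h1 : ‖y s' - y s‖ ≤ R * A := by
      rw [hy, hA, ← intervalIntegral.integral_const_mul]
      exact intervalIntegral.norm_integral_le_of_norm_le hss.le
        (Eventually.of_forall fun r _ => haR r) (ha.const_mul R)
    rw [hv, norm_smul, norm_inv, Real.norm_of_nonneg hA0.le]
    rw [inv_mul_le_iff₀ hA0]
    linarith
  have hseg := le_along_segment (u := v) (y := y s + d) (M := L (y s) v + 2 * η) hLc hWc hsub hA0 hτ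
    fun r hr => by
      refine (hball _ ?_ v hvR).trans_lt (by linarith)
      have h1 : ‖r • v‖ ≤ ‖y s' - y s‖ := by
        rw [← hAv, norm_smul r v, norm_smul A v, Real.norm_of_nonneg hr.1, Real.norm_of_nonneg hA0.le]
        exact mul_le_mul_of_nonneg_right hr.2 (norm_nonneg v)
      rw [dist_eq_norm, show y s + d + r • v - y s = d + r • v by abel]
      exact (norm_add_le _ _).trans (by linarith)
  rw [hAv, show y s + d + (y s' - y s) = y s' + d by abel] at hseg
  obtain ⟨c, p, hcp, hval⟩ := exists_affine_minorant (hconv (y s))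
    (hLc.comp (Continuous.prodMk_right (y s))) v (sub_lt_self (L (y s) v) hη)
  have hpu : IntervalIntegrable (fun r => ⟪p, u r⟫) MeasureTheory.volume s s' :=
    ⟨MeasureTheory.Integrable.const_inner p hu.1, MeasureTheory.Integrable.const_inner p hu.2⟩
  have hFint : IntervalIntegrable (fun r => L (y r) (u r) + (a r - 1) * M)
      MeasureTheory.volume s s' :=
    hLu.add ((ha.sub intervalIntegrable_const).mul_const M)
  have hjensen : ∫ r in s..s', (c * a r + ⟪p, u r⟫) ≤
      ∫ r in s..s', (L (y r) (u r) + (a r - 1) * M + η * a r) := by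
    refine intervalIntegral.integral_mono_on hss.le ((ha.const_mul c).add hpu)
      (hFint.add (ha.const_mul η)) fun r hr => ?_
    have har : 0 < a r := by linarith [ha1 r]
    have h1 := hcp ((a r)⁻¹ • u r)
    have h2 : ‖(a r)⁻¹ • u r‖ ≤ R := by
      rw [norm_smul, norm_inv, Real.norm_of_nonneg har.le, inv_mul_le_iff₀ har]
      linarith [haR r]
    have h3 := (h1.trans (hnear r hr _ h2))
    have h4 := (hconv (y r)).mul_apply_inv_smul_le (ha1 r) (u r)
    have h5 := mul_le_mul_of_nonneg_left h3 har.le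
    have h6 := mul_le_mul_of_nonneg_left (hM r hr) (sub_nonneg.2 (ha1 r))
    rw [inner_smul_right] at h5
    have h7 : a r * (c + (a r)⁻¹ * ⟪p, u r⟫) = c * a r + ⟪p, u r⟫ := by field_simp
    linarith
  have hlin : ∫ r in s..s', (c * a r + ⟪p, u r⟫) = A * (L (y s) v - η) := by
    rw [intervalIntegral.integral_add (ha.const_mul c) hpu, intervalIntegral.integral_const_mul,
      ← hA, ← hval, mul_add, ← inner_smul_right, hAv, hy]
    rw [intervalIntegral.integral_of_le hss.le, intervalIntegral.integral_of_le hss.le,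
      integral_inner hu.1]
    ring
  rw [intervalIntegral.integral_add hFint (ha.const_mul _), intervalIntegral.integral_const_mul,
    ← hA] at hjensen ⊢
  linarith

/-- Comparison of a subsolution at the endpoints of a translated and reparametrised trajectory. -/
theorem exists_le_along_trajectory {n : ℕ} {L : Euc n → Euc n → ℝ} {W : ℝ × Euc n → ℝ}
    (hLc : Continuous (fun q : Euc n × Euc n => L q.1 q.2))
    (hconv : ∀ x, ConvexOn ℝ Set.univ (L x))
    (hWc : ContinuousOn W {q : ℝ × Euc n | 0 < q.1})
    (hsub : ∀ t : ℝ, ∀ x : Euc n, 0 < t → ∀ p ∈ rsupdiffP W (t, x),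
      (p.1 : ℝ) + Ham L x (-p.2) ≤ (0 : EReal))
    {y u : ℝ → Euc n} {a : ℝ → ℝ} {t R M η : ℝ} (ht : 0 < t) (hη : 0 < η)
    (hu : IntervalIntegrable u MeasureTheory.volume 0 t)
    (ha : IntervalIntegrable a MeasureTheory.volume 0 t)
    (hLu : IntervalIntegrable (fun r => L (y r) (u r)) MeasureTheory.volume 0 t)
    (hyc : ContinuousOn y (Icc 0 t))
    (hy : ∀ s ∈ Icc 0 t, ∀ s' ∈ Icc 0 t, y s' - y s = ∫ r in s..s', u r)
    (ha1 : ∀ r, 1 ≤ a r) (haR : ∀ r, ‖u r‖ ≤ R * a r)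
    (hM : ∀ r ∈ Icc 0 t, L (y r) 0 ≤ M) :
    ∃ δ > 0, ∀ d, ‖d‖ ≤ δ → ∀ h > 0, W (h + ∫ r in (0 : ℝ)..t, a r, y 0 + d) ≤
      (∫ r in (0 : ℝ)..t, (L (y r) (u r) + (a r - 1) * M + 4 * η * a r)) + W (h, y t + d) := by
  set K := cthickening 1 (y '' Icc 0 t)
  have hK : IsCompact K := (isCompact_Icc.image_of_continuousOn hyc).cthickening
  have hyK : ∀ r ∈ Icc 0 t, y r ∈ K := fun r hr => self_subset_cthickening _ (mem_image_of_mem y hr)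
  obtain ⟨δ₀, hδ₀, hunif⟩ := Metric.uniformContinuousOn_iff.1
    ((hK.prod (isCompact_closedBall (0 : Euc n) R)).uniformContinuousOn_of_continuous
      hLc.continuousOn) η hη
  have hLdist : ∀ z ∈ K, ∀ z' ∈ K, dist z z' < δ₀ → ∀ v, ‖v‖ ≤ R → L z v ≤ L z' v + η := by
    intro z hz z' hz' hzz v hv
    have hv' : v ∈ closedBall (0 : Euc n) R := by simpa using hv
    have h1 := hunif (z, v) ⟨hz, hv'⟩ (z', v) ⟨hz', hv'⟩ (by
      rw [Prod.dist_eq, dist_self, max_eq_left dist_nonneg]; exact hzz)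
    rw [Real.dist_eq] at h1
    linarith [(abs_lt.1 h1).2]
  set δ := min (δ₀ / 4) (1 / 2)
  have hδ : 0 < δ := by positivity
  have hδ₁ : δ ≤ δ₀ / 4 := min_le_left _ _
  have hδ₂ : δ ≤ 1 / 2 := min_le_right _ _
  obtain ⟨μ, hμ, hyunif⟩ := Metric.uniformContinuousOn_iff.1
    (isCompact_Icc.uniformContinuousOn_of_continuous hyc) δ hδ
  obtain ⟨N, hN⟩ := exists_nat_one_div_lt (div_pos hμ ht)
  have hstep : t / (N + 1) < μ := by
    rw [div_eq_mul_one_div]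
    calc t * (1 / (N + 1)) < t * (μ / t) := mul_lt_mul_of_pos_left hN ht
      _ = μ := by field_simp
  refine ⟨δ, hδ, fun d hd h hh => ?_⟩
  have hF : IntervalIntegrable (fun r => L (y r) (u r) + (a r - 1) * M + 4 * η * a r)
      MeasureTheory.volume 0 t :=
    (hLu.add ((ha.sub intervalIntegrable_const).mul_const M)).add (ha.const_mul _)
  have hsubI : ∀ s ∈ Icc 0 t, ∀ s' ∈ Icc 0 t, uIcc s s' ⊆ uIcc 0 t := fun s hs s' hs' => by
    rw [uIcc_of_le ht.le]
    exact uIcc_subset_Icc hs hs'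
  have h0t : (0 : ℝ) ∈ Icc 0 t := ⟨le_rfl, ht.le⟩
  have htt : t ∈ Icc 0 t := ⟨ht.le, le_rfl⟩
  have hind : ∀ k : ℕ, k ≤ N + 1 → W (h + ∫ r in (0 : ℝ)..t, a r, y 0 + d) ≤
      (∫ r in (0 : ℝ)..(k * (t / (N + 1))),
        (L (y r) (u r) + (a r - 1) * M + 4 * η * a r)) +
      W (h + ∫ r in (k * (t / (N + 1)))..t, a r, y (k * (t / (N + 1))) + d) := by
    intro k
    induction k with
    | zero => intro _; simp
    | succ k ih =>
      intro hk
      refine (ih (by omega)).trans ?_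
      have hkN : ((k : ℝ) + 1) ≤ N + 1 := by exact_mod_cast hk
      have hk0 : (0 : ℝ) ≤ k := k.cast_nonneg
      have hq : 0 < t / (N + 1) := by positivity
      set s := k * (t / (N + 1)) with hs
      have hs' : ((k + 1 : ℕ) : ℝ) * (t / (N + 1)) = s + t / (N + 1) := by push_cast; ring
      rw [hs']
      set s' := s + t / (N + 1) with hs'def
      have hss : s < s' := lt_add_of_pos_right _ hq
      have hs0 : 0 ≤ s := by positivity
      have hst' : s' ≤ t := by
        rw [← hs']
        push_cast
        calc ((k : ℝ) + 1) * (t / (N + 1)) ≤ (N + 1) * (t / (N + 1)) :=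
              mul_le_mul_of_nonneg_right hkN hq.le
          _ = t := by field_simp
      have hsI : s ∈ Icc 0 t := ⟨hs0, hss.le.trans hst'⟩
      have hs'I : s' ∈ Icc 0 t := ⟨hs0.trans hss.le, hst'⟩
      have hIcc : ∀ r ∈ Icc s s', r ∈ Icc 0 t := fun r hr => ⟨hs0.trans hr.1, hr.2.trans hst'⟩
      have hosc : ∀ r ∈ Icc s s', dist (y r) (y s) < δ := fun r hr => by
        refine hyunif r (hIcc r hr) s hsI ?_
        rw [Real.dist_eq, abs_of_nonneg (sub_nonneg.2 hr.1)]
        linarith [hr.2]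
      have hsum : (∫ r in s..s', a r) + ∫ r in s'..t, a r = ∫ r in s..t, a r :=
        intervalIntegral.integral_add_adjacent_intervals (ha.mono_set (hsubI s hsI s' hs'I))
          (ha.mono_set (hsubI s' hs'I t htt))
      have hrem : 0 ≤ ∫ r in s'..t, a r :=
        intervalIntegral.integral_nonneg hst' fun r _ => zero_le_one.trans (ha1 r)
      have harc := le_along_short_arc (y := y) (u := u) (a := a) (R := R) (M := M) (η := η)
        (δ := 2 * δ) (d := d) (τ := h + ∫ r in s..t, a r) hLc hconv hWc hsub hss hη
        (hu.mono_set (hsubI s hsI s' hs'I)) (ha.mono_set (hsubI s hsI s' hs'I))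
        (hLu.mono_set (hsubI s hsI s' hs'I)) (hy s hsI s' hs'I) ha1 haR
        (fun r hr => hM r (hIcc r hr))
        (fun r hr => hLdist _ (hyK s hsI) _ (hyK r (hIcc r hr)) (by
          rw [dist_comm]; linarith [hosc r hr]))
        (fun z hz => hLdist _ (mem_cthickening_of_dist_le z (y s) _ _ (mem_image_of_mem y hsI)
          (by linarith)) _ (hyK s hsI) (by linarith))
        (by
          have := hosc s' ⟨hss.le, le_rfl⟩
          rw [dist_eq_norm] at this
          linarith) (by linarith)
      rw [show h + (∫ r in s..t, a r) - ∫ r in s..s', a r = h + ∫ r in s'..t, a r by linarith]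
        at harc
      rw [← intervalIntegral.integral_add_adjacent_intervals
        (hF.mono_set (hsubI 0 h0t s hsI)) (hF.mono_set (hsubI s hsI s' hs'I))]
      linarith
  have hlast := hind (N + 1) le_rfl
  rw [show ((N + 1 : ℕ) : ℝ) * (t / (N + 1)) = t by push_cast; field_simp,
    intervalIntegral.integral_same, add_zero] at hlast
  exact hlast

/-- A subsolution is dominated by the cost of every trajectory. -/
theorem le_cost_of_subsolution {n : ℕ} {L : Euc n → Euc n → ℝ} {φ : Euc n → EReal}
    {W : ℝ × Euc n → ℝ} (hL0 : ∀ x u, 0 ≤ L x u)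
    (hLc : Continuous (fun q : Euc n × Euc n => L q.1 q.2))
    (hconv : ∀ x, ConvexOn ℝ Set.univ (L x))
    (hWc : ContinuousOn W {q : ℝ × Euc n | 0 < q.1})
    (hinit : ∀ x : Euc n,
      Filter.liminf (fun z : ℝ × Euc n => ((W z : ℝ) : EReal)) ((𝓝[>] (0:ℝ)) ×ˢ 𝓝 x) ≤ φ x)
    (hsub : ∀ t : ℝ, ∀ x : Euc n, 0 < t → ∀ p ∈ rsupdiffP W (t, x),
      (p.1 : ℝ) + Ham L x (-p.2) ≤ (0 : EReal))
    {t : ℝ} (ht : 0 < t) {y u : ℝ → Euc n}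
    (hu : IntervalIntegrable u MeasureTheory.volume 0 t)
    (hLu : IntervalIntegrable (fun r => L (y r) (u r)) MeasureTheory.volume 0 t)
    (hy : ∀ s ∈ Icc 0 t, y s = y 0 + ∫ r in (0 : ℝ)..s, u r) {c : ℝ} (hc : φ (y t) < c) :
    W (t, y 0) ≤ (∫ r in (0 : ℝ)..t, L (y r) (u r)) + c := by
  have hprim : ContinuousOn (fun s => ∫ r in (0 : ℝ)..s, u r) (Icc 0 t) := by
    have h := intervalIntegral.continuousOn_primitive_interval (a := 0) (b := t) (f := u)
      (μ := MeasureTheory.volume) (by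
        rw [uIcc_of_le ht.le, integrableOn_Icc_iff_integrableOn_Ioc]
        exact hu.1)
    rwa [uIcc_of_le ht.le] at h
  have hyc : ContinuousOn y (Icc 0 t) := (continuousOn_const.add hprim).congr hy
  have hsubI : ∀ s ∈ Icc 0 t, ∀ s' ∈ Icc 0 t, uIcc s s' ⊆ uIcc 0 t := fun s hs s' hs' => by
    rw [uIcc_of_le ht.le]
    exact uIcc_subset_Icc hs hs'
  have h0t : (0 : ℝ) ∈ Icc 0 t := ⟨le_rfl, ht.le⟩
  have hyinc : ∀ s ∈ Icc 0 t, ∀ s' ∈ Icc 0 t, y s' - y s = ∫ r in s..s', u r := by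
    intro s hs s' hs'
    rw [hy s hs, hy s' hs', add_sub_add_left_eq_sub]
    exact intervalIntegral.integral_interval_sub_left (hu.mono_set (hsubI 0 h0t s' hs'))
      (hu.mono_set (hsubI 0 h0t s hs))
  obtain ⟨M, hM⟩ := (isCompact_Icc.image_of_continuousOn
    ((hLc.comp (continuous_id.prodMk continuous_const)).comp_continuousOn hyc :
      ContinuousOn (fun r => L (y r) 0) (Icc 0 t))).bddAbove
  have hM' : ∀ r ∈ Icc 0 t, L (y r) 0 ≤ M := fun r hr => hM (mem_image_of_mem _ hr)
  have hM0 : 0 ≤ M := (hL0 _ _).trans (hM' 0 h0t)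
  refine le_of_forall_pos_le_add fun ε hε => ?_
  have hWat : ContinuousAt W (t, y 0) :=
    hWc.continuousAt ((isOpen_lt continuous_const continuous_fst).mem_nhds ht)
  obtain ⟨ρ, hρ, hWρ⟩ := Metric.continuousAt_iff.1 hWat (ε / 4) (by positivity)
  set B := ∫ r in (0 : ℝ)..t, ‖u r‖ with hB
  have hB0 : 0 ≤ B := intervalIntegral.integral_nonneg ht.le fun r _ => norm_nonneg _
  set κ := min (ρ / 4) (ε / (4 * (M + 1))) with hκ
  have hκ0 : 0 < κ := by positivity
  set R := (B + 1) / κ with hR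
  have hR0 : 0 < R := by positivity
  have hBR : B / R ≤ κ := by
    rw [div_le_iff₀ hR0, hR, mul_div_cancel₀ _ hκ0.ne']
    linarith
  set a : ℝ → ℝ := fun r => max 1 (‖u r‖ / R)
  have ha1 : ∀ r, 1 ≤ a r := fun r => le_max_left _ _
  have haR : ∀ r, ‖u r‖ ≤ R * a r := fun r => by
    rw [← div_le_iff₀' hR0]
    exact le_max_right _ _
  have hale : ∀ r, a r ≤ 1 + ‖u r‖ / R := fun r =>
    max_le (le_add_of_nonneg_right (by positivity)) (le_add_of_nonneg_left zero_le_one)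
  have haint : IntervalIntegrable a MeasureTheory.volume 0 t :=
    ⟨(intervalIntegrable_const (c := (1 : ℝ))).1.sup (hu.norm.div_const R).1,
      (intervalIntegrable_const (c := (1 : ℝ))).2.sup (hu.norm.div_const R).2⟩
  set σ := ∫ r in (0 : ℝ)..t, a r with hσ
  have hσ1 : t ≤ σ := by
    have := intervalIntegral.integral_mono_on ht.le intervalIntegrable_const haint
      fun r _ => ha1 r
    simpa using this
  have hσ2 : σ ≤ t + κ := by
    have h1 := intervalIntegral.integral_mono_on ht.le haint
      (intervalIntegrable_const.add (hu.norm.div_const R)) fun r _ => hale r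
    rw [intervalIntegral.integral_add intervalIntegrable_const (hu.norm.div_const R),
      intervalIntegral.integral_div, intervalIntegral.integral_const, smul_eq_mul] at h1
    linarith
  set η := ε / (16 * σ) with hη
  have hσ0 : 0 < σ := ht.trans_le hσ1
  have hη0 : 0 < η := by positivity
  obtain ⟨δ, hδ, hcomp⟩ := exists_le_along_trajectory (y := y) (u := u) (a := a) (R := R) (M := M)
    hLc hconv hWc hsub ht hη0 hu haint hLu hyc hyinc ha1 haR hM'
  have hfreq := frequently_lt_of_liminf_lt (by isBoundedDefault) ((hinit (y t)).trans_lt hc)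
  have hclose : ∀ᶠ z : ℝ × Euc n in (𝓝[>] (0:ℝ)) ×ˢ 𝓝 (y t),
      (0 < z.1 ∧ z.1 < ρ / 4) ∧ dist z.2 (y t) < min δ (ρ / 4) := by
    filter_upwards [prod_mem_prod (Ioo_mem_nhdsGT (show (0 : ℝ) < ρ / 4 by positivity))
      (ball_mem_nhds (y t) (show 0 < min δ (ρ / 4) by positivity))] with z hz
    exact ⟨hz.1, hz.2⟩
  obtain ⟨⟨h, z⟩, hlt, ⟨hh0, hh1⟩, hz⟩ := (hfreq.and_eventually hclose).exists
  rw [EReal.coe_lt_coe_iff] at hlt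
  rw [dist_eq_norm, lt_min_iff] at hz
  have hmain := hcomp (z - y t) hz.1.le h hh0
  rw [← hσ, add_sub_cancel, intervalIntegral.integral_add
      (hLu.add ((haint.sub intervalIntegrable_const).mul_const M)) (haint.const_mul _),
    intervalIntegral.integral_add hLu ((haint.sub intervalIntegrable_const).mul_const M),
    intervalIntegral.integral_mul_const, intervalIntegral.integral_const_mul,
    intervalIntegral.integral_sub haint intervalIntegrable_const, ← hσ,
    intervalIntegral.integral_const, smul_eq_mul] at hmain
  have hnear := hWρ (x := (h + σ, y 0 + (z - y t))) (by
    rw [Prod.dist_eq, max_lt_iff]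
    refine ⟨?_, ?_⟩
    · rw [Real.dist_eq, abs_of_nonneg (by linarith)]
      linarith [min_le_left (ρ / 4) (ε / (4 * (M + 1)))]
    · rw [dist_eq_norm, add_sub_cancel_left]
      linarith)
  rw [Real.dist_eq] at hnear
  have e1 : 4 * η * σ = ε / 4 := by rw [hη]; field_simp; norm_num
  have e2 : (σ - t) * M ≤ ε / 4 := by
    have h1 : κ * (M + 1) ≤ ε / 4 := by
      refine (mul_le_mul_of_nonneg_right (min_le_right _ _) (by positivity)).trans_eq ?_
      field_simp
    have h2 : (σ - t) * M ≤ κ * M := mul_le_mul_of_nonneg_right (by linarith) hM0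
    linarith
  linarith [(abs_lt.1 hnear).1]

/-- The value function dominates every subsolution. -/
theorem le_bolzaValue_of_subsolution {n : ℕ} {L : Euc n → Euc n → ℝ} {φ : Euc n → EReal}
    {W : ℝ × Euc n → ℝ} (hL0 : ∀ x u, 0 ≤ L x u)
    (hLc : Continuous (fun q : Euc n × Euc n => L q.1 q.2))
    (hconv : ∀ x, ConvexOn ℝ Set.univ (L x))
    (hφ0 : ∀ x, 0 ≤ φ x)
    (hWc : ContinuousOn W {q : ℝ × Euc n | 0 < q.1})
    (hinit : ∀ x : Euc n,
      Filter.liminf (fun z : ℝ × Euc n => ((W z : ℝ) : EReal)) ((𝓝[>] (0:ℝ)) ×ˢ 𝓝 x) ≤ φ x)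
    (hsub : ∀ t : ℝ, ∀ x : Euc n, 0 < t → ∀ p ∈ rsupdiffP W (t, x),
      (p.1 : ℝ) + Ham L x (-p.2) ≤ (0 : EReal))
    {t : ℝ} (ht : 0 < t) (x : Euc n) :
    ((W (t, x) : ℝ) : EReal) ≤ bolzaValue L φ t x := by
  refine le_sInf ?_
  rintro _ ⟨u, hu, hLu, rfl⟩
  set y : ℝ → Euc n := fun s => x + ∫ r in (0 : ℝ)..s, u r with hy
  have hy0 : y 0 = x := by simp [hy]
  have hcost : ∀ c : ℝ, φ (y t) < c →
      W (t, x) ≤ (∫ r in (0 : ℝ)..t, L (y r) (u r)) + c := fun c hc => by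
    have h := le_cost_of_subsolution (y := y) hL0 hLc hconv hWc hinit hsub ht hu hLu
      (fun s _ => by rw [hy0]) hc
    rwa [hy0] at h
  change _ ≤ ((∫ r in (0 : ℝ)..t, L (y r) (u r) : ℝ) : EReal) + φ (y t)
  rcases eq_or_ne (φ (y t)) ⊤ with htop | htop
  · rw [htop, EReal.coe_add_top]
    exact le_top
  · lift φ (y t) to ℝ using ⟨htop, fun hbot => by simpa [hbot] using hφ0 (y t)⟩ with b hb
    rw [← EReal.coe_add, EReal.coe_le_coe_iff]
    refine le_of_forall_pos_le_add fun ε hε => ?_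
    have := hcost (b + ε) (EReal.coe_lt_coe_iff.2 (by linarith))
    linarith

theorem stmt18 {n : ℕ} (L : Euc n → Euc n → ℝ) (Θ : Euc n → ℝ) (φ : Euc n → EReal)
    (W : ℝ × Euc n → ℝ)
    (hL0 : ∀ x u, 0 ≤ L x u)
    (hLc : Continuous (fun q : Euc n × Euc n => L q.1 q.2))
    (hconv : ∀ x, ConvexOn ℝ Set.univ (L x))
    (hΘ0 : ∀ u, 0 ≤ Θ u) (hΘsl : Superlinear Θ) (hcoer : ∀ x u, Θ u ≤ L x u)
    (hφ0 : ∀ x, 0 ≤ φ x) (hφlsc : LowerSemicontinuous φ)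
    (hW0 : ∀ q : ℝ × Euc n, 0 < q.1 → 0 ≤ W q)
    (hWc : ContinuousOn W {q : ℝ × Euc n | 0 < q.1})
    (hinit : ∀ x : Euc n,
      Filter.liminf (fun z : ℝ × Euc n => ((W z : ℝ) : EReal)) ((𝓝[>] (0:ℝ)) ×ˢ 𝓝 x) = φ x)
    (htech0 : ∀ t : ℝ, ∀ x : Euc n, 0 < t →
      Dup (fun z => ((W z : ℝ) : EReal)) (t, x) ((0:ℝ), (0:Euc n)) = 0)
    (htech1 : ∀ t : ℝ, ∀ x : Euc n, 0 < t →
      ∃ u : Euc n, Dup (fun z => ((W z : ℝ) : EReal)) (t, x) ((-1:ℝ), u) < ⊤)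
    (hsuper : ∀ t : ℝ, ∀ x : Euc n, 0 < t → ∀ p ∈ rsubdiffP W (t, x),
      (0 : EReal) ≤ (p.1 : ℝ) + Ham L x (-p.2))
    (hsub : ∀ t : ℝ, ∀ x : Euc n, 0 < t → ∀ p ∈ rsupdiffP W (t, x),
      (p.1 : ℝ) + Ham L x (-p.2) ≤ (0 : EReal)) :
    ∀ t : ℝ, ∀ x : Euc n, 0 < t → ((W (t, x) : ℝ) : EReal) = bolzaValue L φ t x :=
  fun t x ht => le_antisymm
    (le_bolzaValue_of_subsolution hL0 hLc hconv hφ0 hWc (fun x => (hinit x).le) hsub ht x)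
    (bolzaValue_le_of_supersolution hL0 hLc hconv hΘ0 hΘsl hcoer hW0 hWc (fun x => (hinit x).ge)
      hsuper ht x)
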